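/- arXiv:1708.07387 — 5 statements merged into one kernel-verified Lean document; each statement's English description precedes it below -/
import Mathlib

section
/- For a, f ∈ [0,1], define V(a,f) = 2⁷ times the 10-dimensional Lebesgue measure of the set {(b,c,d,e,g) ∈ ℂ⁵ : Q(a,f,b,c,d,e,g) is positive semidefinite}. Then, writing a₂ = 1−a and f₂ = 1−f: if a + f ≤ 1 then V(a,f) = (2⁴π⁵/45) · a³ f³ (a²f² − 5·a·a₂·f·f₂ + 10·a₂²f₂²), and if a + f > 1 then V(a,f) = (2⁴π⁵/45) · a₂³ f₂³ (a₂²f₂² − 5·a·a₂·f·f₂ + 10·a²f²). -/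
open MeasureTheory Matrix Real ComplexOrder

/-- The Choi matrix of a general qubit channel with parameters `(a,f,b,c,d,e,g)`. -/
noncomputable def choiMat (a f : ℝ) (b c d e g : ℂ) : Matrix (Fin 4) (Fin 4) ℂ :=
  !![(a : ℂ), b, c, d;
     star b, 1 - (a : ℂ), e, -c;
     star c, star e, (f : ℂ), g;
     star d, -star c, star g, 1 - (f : ℂ)]

theorem choiMat_posSemidef_iff_of_pos_pivots {a f : ℝ} {b c d e g u v : ℂ} {p q : ℝ}
    (ha : 0 < a) (hp : 0 < p) (hq : 0 < q)
    (hpdef : p = 1 - a - Complex.normSq b / a)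
    (hu : u = -c - star b * d / a) (hv : v = e - star b * c / a)
    (hqdef : q = 1 - f - Complex.normSq d / a - Complex.normSq u / p) :
    (choiMat a f b c d e g).PosSemidef ↔
      Complex.normSq (g - (star c * d / a + star v * u / p)) ≤
        q * (f - Complex.normSq c / a - Complex.normSq v / p) := by
  have haC : (a : ℂ) ≠ 0 := by exact_mod_cast ha.ne'
  have hpC : (p : ℂ) ≠ 0 := by exact_mod_cast hp.ne'
  have hqC : (q : ℂ) ≠ 0 := by exact_mod_cast hq.ne'
  set w : ℂ := g - (star c * d / a + star v * u / p) with hw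
  set k : ℝ := f - Complex.normSq c / a - Complex.normSq v / p - Complex.normSq w / q with hk
  let U : Matrix (Fin 4) (Fin 4) ℂ :=
    !![1, 0, 0, 0;
       star b / a, 1, 0, 0;
       star c / a, star v / p, w / q, 1;
       star d / a, star u / p, 1, 0]
  have hU : IsUnit U := by
    rw [Matrix.isUnit_iff_isUnit_det]
    have : U.det = -1 := by
      simp [U, Matrix.det_succ_row_zero, Fin.sum_univ_succ, Fin.succAbove]
    rw [this]; exact isUnit_one.neg
  have hM : choiMat a f b c d e g =
      U * Matrix.diagonal (fun i => ((![a, p, q, k] i : ℝ) : ℂ)) * star U := by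
    have hb : (Complex.normSq b : ℂ) = star b * b := Complex.normSq_eq_conj_mul_self
    have hc : (Complex.normSq c : ℂ) = star c * c := Complex.normSq_eq_conj_mul_self
    have hd : (Complex.normSq d : ℂ) = star d * d := Complex.normSq_eq_conj_mul_self
    have huu : (Complex.normSq u : ℂ) = star u * u := Complex.normSq_eq_conj_mul_self
    have hvv : (Complex.normSq v : ℂ) = star v * v := Complex.normSq_eq_conj_mul_self
    have hww : (Complex.normSq w : ℂ) = star w * w := Complex.normSq_eq_conj_mul_self
    have e1 : 1 - (a : ℂ) = p + star b * b / a := by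
      rw [hpdef]; push_cast; rw [hb]; ring
    have e2 : 1 - (f : ℂ) = q + star d * d / a + star u * u / p := by
      rw [hqdef]; push_cast; rw [hd, huu]; ring
    have e3 : (f : ℂ) = k + star c * c / a + star v * v / p + star w * w / q := by
      rw [hk]; push_cast; rw [hc, hvv, hww]; ring
    have e4 : -c = u + star b * d / a := by rw [hu]; ring
    have e5 : e = v + star b * c / a := by rw [hv]; ring
    have e6 : g = w + (star c * d / a + star v * u / p) := by rw [hw]; ring
    have e4' : -star c = star u + star d * b / a := by
      rw [← star_neg, e4]; simp [mul_comm]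
    have hsa : star (a : ℂ) = a := Complex.conj_ofReal a
    have hsp : star (p : ℂ) = p := Complex.conj_ofReal p
    have hsq : star (q : ℂ) = q := Complex.conj_ofReal q
    ext i j
    have hcm : choiMat a f b c d e g = !![(a : ℂ), b, c, d;
       star b, p + star b * b / a, v + star b * c / a, u + star b * d / a;
       star c, star v + star c * b / a, k + star c * c / a + star v * v / p + star w * w / q,
        w + (star c * d / a + star v * u / p);
       star d, star u + star d * b / a, star w + (star d * c / a + star u * v / p),
        q + star d * d / a + star u * u / p] := by
      unfold choiMat
      have e5' : star e = star v + star c * b / a := by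
        rw [e5]; simp only [star_add, star_mul', star_div₀, star_star, hsa]; ring
      have e6' : star g = star w + (star d * c / a + star u * v / p) := by
        rw [e6]; simp only [star_add, star_mul', star_div₀, star_star, hsa, hsp]; ring
      rw [e5', e6', e1, e2, e3, e4', e4, e5, e6]
    rw [hcm]
    rw [Matrix.mul_apply]
    simp only [Matrix.mul_diagonal, Fin.sum_univ_four, Matrix.star_apply]
    clear_value w k
    clear hcm e1 e2 e3 e4 e5 e6 e4' hb hc hd huu hvv hww hU hu hv hqdef hpdef
    fin_cases i <;> fin_cases j <;>
      simp [U, -Complex.star_def, hsa, hsp, hsq] <;> field_simp <;> ring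
  rw [hM, Matrix.IsUnit.posSemidef_star_right_conjugate_iff hU, Matrix.posSemidef_diagonal_iff]
  have : (∀ i, (0 : ℂ) ≤ ((![a, p, q, k] i : ℝ) : ℂ)) ↔ 0 ≤ k := by
    simp only [Complex.zero_le_real, Fin.forall_fin_succ]
    simp [ha.le, hp.le, hq.le]
  rw [this, hk, sub_nonneg, div_le_iff₀ hq, mul_comm]

theorem volume_normSq_sub_le (z₀ : ℂ) (k : ℝ) :
    volume {z : ℂ | Complex.normSq (z - z₀) ≤ k} = ENNReal.ofReal (π * k) := by
  rcases lt_or_ge k 0 with hk | hk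
  · have : {z : ℂ | Complex.normSq (z - z₀) ≤ k} = ∅ := by
      ext z
      simpa using hk.trans_le (Complex.normSq_nonneg _)
    rw [this, measure_empty, ENNReal.ofReal_of_nonpos]
    exact mul_nonpos_of_nonneg_of_nonpos pi_pos.le hk.le
  · have : {z : ℂ | Complex.normSq (z - z₀) ≤ k} = Metric.closedBall z₀ (√k) := by
      ext z
      rw [Metric.mem_closedBall, dist_eq_norm, Real.le_sqrt (norm_nonneg _) hk,
        ← Complex.normSq_eq_norm_sq, Set.mem_ofPred_eq]
    rw [this, Complex.volume_closedBall, ← ENNReal.ofReal_pow (sqrt_nonneg _), Real.sq_sqrt hk,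
      ENNReal.ofReal_mul pi_pos.le, mul_comm]
    congr 1
    rw [ENNReal.ofReal, Real.toNNReal_of_nonneg pi_pos.le]; rfl

theorem map_normSq_volume :
    (volume : Measure ℂ).map Complex.normSq =
      ENNReal.ofReal π • (volume : Measure ℝ).restrict (Set.Ici 0) := by
  have hm : Measurable Complex.normSq := Complex.continuous_normSq.measurable
  have hball (k : ℝ) : volume (Complex.normSq ⁻¹' Set.Iic k) = ENNReal.ofReal (π * k) := by
    rw [← volume_normSq_sub_le 0 k]; simp [Set.preimage, Set.mem_Iic]
  have htop (k : ℝ) : (volume : Measure ℂ).map Complex.normSq (Set.Iic k) ≠ ⊤ := by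
    rw [Measure.map_apply hm measurableSet_Iic, hball]
    exact ENNReal.ofReal_ne_top
  have hIic (k : ℝ) : (volume : Measure ℂ).map Complex.normSq (Set.Iic k) =
      (ENNReal.ofReal π • (volume : Measure ℝ).restrict (Set.Ici 0)) (Set.Iic k) := by
    rw [Measure.map_apply hm measurableSet_Iic, hball, Measure.smul_apply,
      Measure.restrict_apply measurableSet_Iic, Set.Iic_inter_Ici, Real.volume_Icc, sub_zero,
      smul_eq_mul, ENNReal.ofReal_mul pi_pos.le]
  refine Measure.ext_of_Ioc' _ _
    (fun x y _ => measure_ne_top_of_subset Set.Ioc_subset_Iic_self (htop y)) fun x y hxy => ?_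
  have hdiff : Set.Ioc x y = Set.Iic y \ Set.Iic x := by ext; simp [and_comm]
  rw [hdiff, measure_sdiff (Set.Iic_subset_Iic.2 hxy.le)
    measurableSet_Iic.nullMeasurableSet (htop x), measure_sdiff (Set.Iic_subset_Iic.2 hxy.le)
    measurableSet_Iic.nullMeasurableSet (hIic x ▸ htop x), hIic, hIic]

theorem lintegral_normSq {F : ℝ → ENNReal} (hF : Measurable F) :
    ∫⁻ z : ℂ, F (Complex.normSq z) = ENNReal.ofReal π * ∫⁻ t in Set.Ici 0, F t := by
  rw [← lintegral_map hF Complex.continuous_normSq.measurable, map_normSq_volume,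
    lintegral_smul_measure, smul_eq_mul]

theorem ae_normSq_sub_ne (z₀ : ℂ) (k : ℝ) : ∀ᵐ z : ℂ, Complex.normSq (z - z₀) ≠ k := by
  have h0 : ∀ᵐ z : ℂ, Complex.normSq z ≠ k := by
    have : ∀ᵐ t ∂((volume : Measure ℂ).map Complex.normSq), t ≠ k := by
      rw [map_normSq_volume]
      exact Measure.ae_smul_measure (ae_restrict_of_ae (Measure.ae_ne volume k)) _
    exact ae_of_ae_map Complex.continuous_normSq.measurable.aemeasurable this
  exact (measurePreserving_sub_right volume z₀).quasiMeasurePreserving.ae h0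

theorem setLIntegral_Ici_ofReal_sub_mul {s : ℝ} (hs : 0 ≤ s) {G : ℝ → ℝ} (hG : Continuous G)
    (hG0 : ∀ t ∈ Set.Icc 0 s, 0 ≤ G t) {F : ℝ → ENNReal}
    (hFG : ∀ t ∈ Set.Icc 0 s, F t = ENNReal.ofReal (G t)) (hF0 : ∀ t, s < t → F t = 0) :
    ∫⁻ t in Set.Ici 0, F t = ENNReal.ofReal (∫ t in (0 : ℝ)..s, G t) := by
  have h1 : Set.EqOn F ((Set.Icc 0 s).indicator fun t => ENNReal.ofReal (G t)) (Set.Ici 0) := by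
    intro t ht
    by_cases hts : t ≤ s
    · rw [Set.indicator_of_mem (show t ∈ Set.Icc 0 s from ⟨ht, hts⟩), hFG t ⟨ht, hts⟩]
    · rw [Set.indicator_of_notMem (fun h => hts h.2), hF0 t (not_le.1 hts)]
  rw [setLIntegral_congr_fun measurableSet_Ici h1, setLIntegral_indicator measurableSet_Icc,
    Set.inter_eq_left.2 Set.Icc_subset_Ici_self, intervalIntegral.integral_of_le hs,
    ← integral_Icc_eq_integral_Ioc, ofReal_integral_eq_lintegral_ofReal
      hG.continuousOn.integrableOn_Icc]
  exact (ae_restrict_iff' measurableSet_Icc).2 (.of_forall hG0)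

theorem lintegral_ofReal_sub_normSq_div_pow (m : ℕ) (z₀ : ℂ) (k : ℝ) {q : ℝ} (hq : 0 < q) :
    ∫⁻ z : ℂ, ENNReal.ofReal (k - Complex.normSq (z - z₀) / q) ^ (m + 1) =
      ENNReal.ofReal (π * q / (m + 2)) * ENNReal.ofReal k ^ (m + 2) := by
  rw [lintegral_sub_right_eq_self
    (fun z => ENNReal.ofReal (k - Complex.normSq z / q) ^ (m + 1)) z₀,
    lintegral_normSq (F := fun t => ENNReal.ofReal (k - t / q) ^ (m + 1)) (by fun_prop)]
  rcases lt_or_ge k 0 with hk | hk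
  · rw [setLIntegral_congr_fun (g := fun _ => 0) measurableSet_Ici]
    · simp [ENNReal.ofReal_of_nonpos hk.le]
    · intro t ht
      have : k - t / q ≤ 0 := by linarith [div_nonneg (Set.mem_Ici.1 ht) hq.le]
      simp [ENNReal.ofReal_of_nonpos this]
  · rw [setLIntegral_Ici_ofReal_sub_mul (s := k * q) (G := fun t => (k - t / q) ^ (m + 1))
      (by positivity) (by fun_prop)]
    · have : ∫ t in (0 : ℝ)..k * q, (k - t / q) ^ (m + 1) = q / (m + 2) * k ^ (m + 2) := by
        rw [intervalIntegral.integral_comp_sub_div (fun x => x ^ (m + 1)) hq.ne', integral_pow]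
        simp [hq.ne']
        field_simp
        ring
      rw [this, ← ENNReal.ofReal_pow hk, ← ENNReal.ofReal_mul (by positivity),
        ← ENNReal.ofReal_mul (by positivity)]
      ring_nf
    · rintro t ⟨-, ht⟩
      have : t / q ≤ k := (div_le_iff₀ hq).2 ht
      exact pow_nonneg (by linarith) _
    · rintro t ⟨-, ht⟩
      have : t / q ≤ k := (div_le_iff₀ hq).2 ht
      rw [ENNReal.ofReal_pow (by linarith)]
    · intro t ht
      have : k < t / q := (lt_div_iff₀ hq).2 ht
      simp [ENNReal.ofReal_of_nonpos (by linarith : k - t / q ≤ 0)]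

theorem lintegral_ofReal_sub_normSq_sq_mul {s r : ℝ} (hs : 0 ≤ s) (hsr : s ≤ r) :
    ∫⁻ c : ℂ, ENNReal.ofReal (s - Complex.normSq c) ^ 2 * ENNReal.ofReal (r - Complex.normSq c) ^ 2
      = ENNReal.ofReal (π * (s ^ 3 * (s ^ 2 - 5 * s * r + 10 * r ^ 2) / 30)) := by
  rw [lintegral_normSq (F := fun t => ENNReal.ofReal (s - t) ^ 2 * ENNReal.ofReal (r - t) ^ 2)
    (by fun_prop), setLIntegral_Ici_ofReal_sub_mul (s := s)
      (G := fun t => (s - t) ^ 2 * (r - t) ^ 2) hs (by fun_prop) (fun t _ => by positivity)]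
  · have : ∫ t in (0 : ℝ)..s, (s - t) ^ 2 * (r - t) ^ 2 =
        s ^ 3 * (s ^ 2 - 5 * s * r + 10 * r ^ 2) / 30 := by
      have h (t : ℝ) : HasDerivAt (fun t : ℝ => -((s - t) ^ 5 / 5 + (r - s) * (s - t) ^ 4 / 2
          + (r - s) ^ 2 * (s - t) ^ 3 / 3)) ((s - t) ^ 2 * (r - t) ^ 2) t := by
        have h0 : HasDerivAt (fun t : ℝ => s - t) (-1) t := by
          simpa using (hasDerivAt_id t).const_sub s
        exact (((((h0.pow 5).div_const 5).add (((h0.pow 4).const_mul (r - s)).div_const 2)).add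
          (((h0.pow 3).const_mul ((r - s) ^ 2)).div_const 3)).neg).congr_deriv (by push_cast; ring)
      rw [intervalIntegral.integral_eq_sub_of_hasDerivAt (fun t _ => h t)
        (Continuous.intervalIntegrable (by fun_prop) _ _)]
      ring
    rw [this, ENNReal.ofReal_mul pi_pos.le]
  · rintro t ⟨-, ht⟩
    rw [ENNReal.ofReal_mul (by positivity), ENNReal.ofReal_pow (by linarith),
      ENNReal.ofReal_pow (by linarith)]
  · intro t ht
    simp [ENNReal.ofReal_of_nonpos (by linarith : s - t ≤ 0)]

theorem normSq_le_of_choiMat_posSemidef {a f : ℝ} {b c d e g : ℂ}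
    (h : (choiMat a f b c d e g).PosSemidef) :
    Complex.normSq c ≤ a * f ∧ Complex.normSq c ≤ (1 - a) * (1 - f) := by
  have hc : star c * c = (Complex.normSq c : ℂ) := Complex.normSq_eq_conj_mul_self.symm
  constructor
  · have h1 := (h.submatrix ![0, 2]).det_nonneg
    rw [Matrix.det_fin_two] at h1
    have h2 : (0 : ℂ) ≤ ((a * f - Complex.normSq c : ℝ) : ℂ) := by
      convert h1 using 1
      push_cast
      rw [← hc]
      simp [choiMat]
      ring
    linarith [Complex.zero_le_real.1 h2]
  · have h1 := (h.submatrix ![1, 3]).det_nonneg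
    rw [Matrix.det_fin_two] at h1
    have h2 : (0 : ℂ) ≤ (((1 - a) * (1 - f) - Complex.normSq c : ℝ) : ℂ) := by
      convert h1 using 1
      push_cast
      rw [← hc]
      simp [choiMat]
      ring
    linarith [Complex.zero_le_real.1 h2]

theorem det_nonneg_of_choiMat_posSemidef {a f : ℝ} {b c d e g : ℂ} (ha : 0 < 1 - a)
    (hr : 0 < (1 - a) * (1 - f) - Complex.normSq c)
    (h : (choiMat a f b c d e g).PosSemidef) :
    0 ≤ a - Complex.normSq b / (1 - a) - Complex.normSq (d - -(b * c / ((1 - a : ℝ) : ℂ))) /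
      (((1 - a) * (1 - f) - Complex.normSq c) / (1 - a)) := by
  have h1 := (Complex.nonneg_iff.1 (h.submatrix ![0, 1, 3]).det_nonneg).1
  rw [Matrix.det_fin_three] at h1
  refine nonneg_of_mul_nonneg_right (h1.trans_eq ?_) hr
  have e : (d - -(b * c / ((1 - a : ℝ) : ℂ))) =
      ((1 - a : ℝ) : ℂ)⁻¹ * (((1 - a : ℝ) : ℂ) * d + b * c) := by
    have : ((1 - a : ℝ) : ℂ) ≠ 0 := by exact_mod_cast ha.ne'
    field_simp
    ring
  rw [e, Complex.normSq_mul, Complex.normSq_inv, Complex.normSq_ofReal]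
  have hr' := hr.ne'
  have ha' := ha.ne'
  field_simp
  simp [choiMat, Complex.normSq_apply]
  ring

theorem lintegral_volume_choiMat_posSemidef {a f : ℝ} {b c d : ℂ} (ha : 0 < a) (ha' : 0 < 1 - a)
    (hs : 0 < a * f - Complex.normSq c) (hr : 0 < (1 - a) * (1 - f) - Complex.normSq c)
    (hP : Complex.normSq (d - -(b * c / ((1 - a : ℝ) : ℂ))) ≠
      (a - Complex.normSq b / (1 - a)) * (((1 - a) * (1 - f) - Complex.normSq c) / (1 - a))) :
    ∫⁻ e, volume {g : ℂ | (choiMat a f b c d e g).PosSemidef} =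
      ENNReal.ofReal (π ^ 2 / 2 * (a * f - Complex.normSq c) ^ 2 *
        ((1 - a) * (1 - f) - Complex.normSq c) / a ^ 3) *
      ENNReal.ofReal (a - Complex.normSq b / (1 - a) -
        Complex.normSq (d - -(b * c / ((1 - a : ℝ) : ℂ))) /
          (((1 - a) * (1 - f) - Complex.normSq c) / (1 - a))) := by
  set r := (1 - a) * (1 - f) - Complex.normSq c with hr_def
  set D := d - -(b * c / ((1 - a : ℝ) : ℂ)) with hD
  set P := a - Complex.normSq b / (1 - a) - Complex.normSq D / (r / (1 - a)) with hP_def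
  have hra : 0 < r / (1 - a) := div_pos hr ha'
  have hP0 : P ≠ 0 := fun h0 => hP (((div_eq_iff hra.ne').1 (sub_eq_zero.1 h0).symm))
  rcases hP0.lt_or_gt with hneg | hpos
  · have : ∀ e, {g : ℂ | (choiMat a f b c d e g).PosSemidef} = ∅ := fun e =>
      Set.eq_empty_of_forall_notMem fun g hg =>
        hneg.not_ge (det_nonneg_of_choiMat_posSemidef ha' hr hg)
    simp [this, ENNReal.ofReal_of_nonpos hneg.le]
  · set p := 1 - a - Complex.normSq b / a with hp_def
    set u := -c - star b * d / a with hu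
    set q := 1 - f - Complex.normSq d / a - Complex.normSq u / p with hq_def
    have hp : 0 < p := by
      have h1 : 0 < a - Complex.normSq b / (1 - a) := by
        linarith [div_nonneg (Complex.normSq_nonneg D) hra.le]
      have h2 : p = (a - Complex.normSq b / (1 - a)) * ((1 - a) / a) := by
        rw [hp_def]; field_simp
      rw [h2]; positivity
    have hpq : a * p * q = r * P := by
      have eD : D = ((1 - a : ℝ) : ℂ)⁻¹ * (((1 - a : ℝ) : ℂ) * d + b * c) := by
        have : ((1 - a : ℝ) : ℂ) ≠ 0 := by exact_mod_cast ha'.ne'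
        rw [hD]
        field_simp
        ring
      have eu : u = (a : ℂ)⁻¹ * (-(a * c) - star b * d) := by
        have : (a : ℂ) ≠ 0 := by exact_mod_cast ha.ne'
        rw [hu]
        field_simp
      have e1 : p * q = p * (1 - f - Complex.normSq d / a) - Complex.normSq u := by
        rw [hq_def]; field_simp
      have e2 : r * P = r * (a - Complex.normSq b / (1 - a)) - (1 - a) * Complex.normSq D := by
        rw [hP_def]; field_simp
      rw [mul_assoc, e1, e2, eD, eu, hp_def, hr_def]
      simp only [Complex.normSq_mul, Complex.normSq_inv, Complex.normSq_ofReal]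
      field_simp
      simp [Complex.normSq_apply]
      ring
    have hq : 0 < q := by
      have : q = r * P / (a * p) := by rw [← hpq]; field_simp
      rw [this]; positivity
    have hk : f - Complex.normSq c / a = (a * f - Complex.normSq c) / a := by field_simp
    have hvol (e : ℂ) : volume {g : ℂ | (choiMat a f b c d e g).PosSemidef} =
        ENNReal.ofReal (π * q) * ENNReal.ofReal ((a * f - Complex.normSq c) / a -
          Complex.normSq (e - star b * c / a) / p) ^ (0 + 1) := by
      simp only [choiMat_posSemidef_iff_of_pos_pivots ha hp hq hp_def hu rfl hq_def]
      rw [volume_normSq_sub_le, zero_add, pow_one, ← ENNReal.ofReal_mul (by positivity), hk,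
        mul_assoc]
    simp only [hvol]
    rw [lintegral_const_mul' _ _ ENNReal.ofReal_ne_top, lintegral_ofReal_sub_normSq_div_pow _ _ _ hp,
      ← ENNReal.ofReal_pow (by positivity), ← ENNReal.ofReal_mul (by positivity),
      ← ENNReal.ofReal_mul (by positivity), ← ENNReal.ofReal_mul (by positivity)]
    congr 1
    have : q = r * P / (a * p) := by rw [← hpq]; field_simp
    rw [this, div_pow]
    field_simp
    norm_num
    ring

theorem lintegral_lintegral_lintegral_volume_choiMat_posSemidef {a f : ℝ} {c : ℂ}
    (ha : 0 < a) (ha' : 0 < 1 - a)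
    (hs : 0 < a * f - Complex.normSq c) (hr : 0 < (1 - a) * (1 - f) - Complex.normSq c) :
    ∫⁻ b, ∫⁻ d, ∫⁻ e, volume {g : ℂ | (choiMat a f b c d e g).PosSemidef} =
      ENNReal.ofReal (π ^ 4 / 12) * (ENNReal.ofReal (a * f - Complex.normSq c) ^ 2 *
        ENNReal.ofReal ((1 - a) * (1 - f) - Complex.normSq c) ^ 2) := by
  have hd (b : ℂ) : ∫⁻ d, ∫⁻ e, volume {g : ℂ | (choiMat a f b c d e g).PosSemidef} =
      ENNReal.ofReal (π ^ 3 / 4 * (a * f - Complex.normSq c) ^ 2 *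
        ((1 - a) * (1 - f) - Complex.normSq c) ^ 2 / (a ^ 3 * (1 - a))) *
        ENNReal.ofReal (a - Complex.normSq (b - 0) / (1 - a)) ^ (1 + 1) := by
    rw [lintegral_congr_ae ((ae_normSq_sub_ne _ _).mono fun d hd =>
      lintegral_volume_choiMat_posSemidef ha ha' hs hr hd),
      lintegral_const_mul' _ _ ENNReal.ofReal_ne_top]
    have := lintegral_ofReal_sub_normSq_div_pow 0 (-(b * c / ((1 - a : ℝ) : ℂ)))
      (a - Complex.normSq b / (1 - a)) (div_pos hr ha')
    simp only [zero_add, pow_one] at this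
    rw [this, ← mul_assoc, ← ENNReal.ofReal_mul (by positivity), sub_zero]
    congr 2
    field_simp
    norm_num
  simp only [hd]
  rw [lintegral_const_mul' _ _ ENNReal.ofReal_ne_top, lintegral_ofReal_sub_normSq_div_pow _ _ _ ha',
    ← ENNReal.ofReal_pow (by positivity), ← ENNReal.ofReal_pow (by positivity),
    ← ENNReal.ofReal_pow (by positivity), ← ENNReal.ofReal_mul (by positivity),
    ← ENNReal.ofReal_mul (by positivity), ← ENNReal.ofReal_mul (by positivity),
    ← ENNReal.ofReal_mul (by positivity)]
  congr 1
  field_simp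
  norm_num
  ring

theorem measurableSet_choiMat_posSemidef (a f : ℝ) :
    MeasurableSet {p : ℂ × ℂ × ℂ × ℂ × ℂ |
      (choiMat a f p.1 p.2.1 p.2.2.1 p.2.2.2.1 p.2.2.2.2).PosSemidef} := by
  have hM : Continuous fun p : ℂ × ℂ × ℂ × ℂ × ℂ =>
      choiMat a f p.1 p.2.1 p.2.2.1 p.2.2.2.1 p.2.2.2.2 := by
    refine continuous_matrix fun i j => ?_
    fin_cases i <;> fin_cases j <;> simp [choiMat] <;> fun_prop
  simp only [Matrix.posSemidef_iff_dotProduct_mulVec]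
  have hclosed : IsClosed {p : ℂ × ℂ × ℂ × ℂ × ℂ | ∀ x : Fin 4 → ℂ,
      0 ≤ star x ⬝ᵥ choiMat a f p.1 p.2.1 p.2.2.1 p.2.2.2.1 p.2.2.2.2 *ᵥ x} := by
    rw [Set.ofPred_forall]
    exact isClosed_iInter fun x => isClosed_le continuous_const
      (Continuous.dotProduct continuous_const (hM.matrix_mulVec continuous_const))
  exact ((isClosed_eq hM.matrix_conjTranspose hM).inter hclosed).measurableSet

theorem volume_choiMat_posSemidef_eq_lintegral (a f : ℝ) :
    volume {p : ℂ × ℂ × ℂ × ℂ × ℂ |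
        (choiMat a f p.1 p.2.1 p.2.2.1 p.2.2.2.1 p.2.2.2.2).PosSemidef} =
      ∫⁻ c, ∫⁻ b, ∫⁻ d, ∫⁻ e, volume {g : ℂ | (choiMat a f b c d e g).PosSemidef} := by
  set S := {p : ℂ × ℂ × ℂ × ℂ × ℂ |
    (choiMat a f p.1 p.2.1 p.2.2.1 p.2.2.2.1 p.2.2.2.2).PosSemidef} with hS_def
  have hS : MeasurableSet S := measurableSet_choiMat_posSemidef a f
  have hS' : MeasurableSet ((MeasurableEquiv.prodAssoc : (ℂ × ℂ) × ℂ × ℂ × ℂ ≃ᵐ _) ⁻¹' S) :=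
    MeasurableEquiv.prodAssoc.measurable hS
  rw [Measure.volume_eq_prod, Measure.prod_apply hS]
  have h1 (b : ℂ) : volume (Prod.mk b ⁻¹' S) =
      ∫⁻ c, volume (Prod.mk c ⁻¹' (Prod.mk b ⁻¹' S)) := by
    rw [Measure.volume_eq_prod, Measure.prod_apply (measurable_prodMk_left hS)]
  simp only [h1]
  rw [lintegral_lintegral_swap]
  · refine lintegral_congr fun c => lintegral_congr fun b => ?_
    rw [Measure.volume_eq_prod, Measure.prod_apply (measurable_prodMk_left (measurable_prodMk_left hS))]
    refine lintegral_congr fun d => ?_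
    rw [Measure.volume_eq_prod, Measure.prod_apply 
      (measurable_prodMk_left (measurable_prodMk_left (measurable_prodMk_left hS)))]
    rfl
  · exact (measurable_measure_prodMk_left hS').aemeasurable

theorem volume_choiMat_posSemidef {a f : ℝ} (ha : a ∈ Set.Icc (0 : ℝ) 1) :
    volume {p : ℂ × ℂ × ℂ × ℂ × ℂ |
        (choiMat a f p.1 p.2.1 p.2.2.1 p.2.2.2.1 p.2.2.2.2).PosSemidef} =
      ENNReal.ofReal (π ^ 4 / 12) * ∫⁻ c : ℂ, ENNReal.ofReal (a * f - Complex.normSq c) ^ 2 *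
        ENNReal.ofReal ((1 - a) * (1 - f) - Complex.normSq c) ^ 2 := by
  rw [volume_choiMat_posSemidef_eq_lintegral, ← lintegral_const_mul' _ _ ENNReal.ofReal_ne_top]
  refine lintegral_congr_ae ?_
  filter_upwards [ae_normSq_sub_ne 0 (a * f), ae_normSq_sub_ne 0 ((1 - a) * (1 - f))] with c h1 h2
  rw [sub_zero] at h1 h2
  by_cases h : Complex.normSq c < a * f ∧ Complex.normSq c < (1 - a) * (1 - f)
  · have hs := sub_pos.2 h.1
    have hr := sub_pos.2 h.2
    have ha0 : 0 < a := ha.1.lt_of_ne fun h0 => by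
      have := Complex.normSq_nonneg c
      rw [← h0] at hs
      linarith
    have ha1 : 0 < 1 - a := (sub_nonneg.2 ha.2).lt_of_ne fun h0 => by
      have := Complex.normSq_nonneg c
      rw [← h0] at hr
      linarith
    exact lintegral_lintegral_lintegral_volume_choiMat_posSemidef ha0 ha1 hs hr
  · have hempty (b d e : ℂ) : {g : ℂ | (choiMat a f b c d e g).PosSemidef} = ∅ :=
      Set.eq_empty_of_forall_notMem fun g hg =>
        have := normSq_le_of_choiMat_posSemidef hg
        h ⟨this.1.lt_of_ne h1, this.2.lt_of_ne h2⟩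
    have hz : ENNReal.ofReal (a * f - Complex.normSq c) ^ 2 *
        ENNReal.ofReal ((1 - a) * (1 - f) - Complex.normSq c) ^ 2 = 0 := by
      rcases not_and_or.1 h with h | h
      · simp [ENNReal.ofReal_of_nonpos (sub_nonpos.2 (not_lt.1 h))]
      · simp [ENNReal.ofReal_of_nonpos (sub_nonpos.2 (not_lt.1 h))]
    simp [hempty, hz]

/-- The distribution of the volume of qubit channels over classical channels:
for `a, f ∈ [0,1]`, with `a₂ = 1−a`, `f₂ = 1−f`, `2⁷` times the 10-dimensional Lebesgue
measure of the set of `(b,c,d,e,g) ∈ ℂ⁵` making the Choi matrix positive semidefinite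
equals `(2⁴π⁵/45)·a³f³(a²f² − 5aa₂ff₂ + 10a₂²f₂²)` when `a + f ≤ 1`, and
`(2⁴π⁵/45)·a₂³f₂³(a₂²f₂² − 5aa₂ff₂ + 10a²f²)` when `a + f > 1`. -/
theorem volume_over_classical (a f : ℝ) (ha : a ∈ Set.Icc (0 : ℝ) 1)
    (hf : f ∈ Set.Icc (0 : ℝ) 1) :
    2 ^ 7 * volume {p : ℂ × ℂ × ℂ × ℂ × ℂ |
        (choiMat a f p.1 p.2.1 p.2.2.1 p.2.2.2.1 p.2.2.2.2).PosSemidef}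
      = if a + f ≤ 1 then
          ENNReal.ofReal (2 ^ 4 * π ^ 5 / 45 * (a ^ 3 * f ^ 3
            * (a ^ 2 * f ^ 2 - 5 * a * (1 - a) * f * (1 - f)
                + 10 * (1 - a) ^ 2 * (1 - f) ^ 2)))
        else
          ENNReal.ofReal (2 ^ 4 * π ^ 5 / 45 * ((1 - a) ^ 3 * (1 - f) ^ 3
            * ((1 - a) ^ 2 * (1 - f) ^ 2 - 5 * a * (1 - a) * f * (1 - f)
                + 10 * a ^ 2 * f ^ 2))) := by
  have h27 : (2 : ENNReal) ^ 7 = ENNReal.ofReal (2 ^ 7) := by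
    rw [ENNReal.ofReal_pow (by norm_num)]
    norm_num
  rw [volume_choiMat_posSemidef ha, h27]
  split_ifs with h
  · rw [lintegral_ofReal_sub_normSq_sq_mul (mul_nonneg ha.1 hf.1) (by linarith),
      ← ENNReal.ofReal_mul (by positivity), ← ENNReal.ofReal_mul (by positivity)]
    congr 1
    ring
  · simp only [mul_comm (ENNReal.ofReal (a * f - _) ^ 2)]
    rw [lintegral_ofReal_sub_normSq_sq_mul
        (mul_nonneg (sub_nonneg.2 ha.2) (sub_nonneg.2 hf.2)) (by linarith),
      ← ENNReal.ofReal_mul (by positivity), ← ENNReal.ofReal_mul (by positivity)]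
    congr 1
    ring
end

section
/- The volume of the space 𝒬 of all qubit channels equals 2π⁵/4725; that is, 2⁷ times the 12-dimensional Lebesgue measure of the set {(a,f,b,c,d,e,g) ∈ [0,1]² × ℂ⁵ : Q(a,f,b,c,d,e,g) is positive semidefinite} equals 2π⁵/4725. -/
open MeasureTheory Matrix Real ComplexOrder

namespace QubitChannel

/-- The determinant of `!![p, c; star c, q]`. -/
noncomputable def det₂ (p q : ℝ) (c : ℂ) : ℝ := p * q - Complex.normSq c

/-- The determinant of `!![a, b, c; star b, 1 - a, e; star c, star e, f]`. -/
noncomputable def det₃ (a f : ℝ) (b c e : ℂ) : ℝ :=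
  a * (1 - a) * f + 2 * (b * e * star c).re - a * Complex.normSq e
    - (1 - a) * Complex.normSq c - f * Complex.normSq b

/-- The minor of the Choi matrix on the rows `0, 1, 2` and the columns `0, 1, 3`. -/
noncomputable def offMinor (a : ℝ) (b c d e g : ℂ) : ℂ :=
  det₂ a (1 - a) b * g - (star c * ((1 - a) * d + b * c) - star e * (star b * d + a * c))

/-- The triangular factor of the Choi matrix. -/
noncomputable def triFactor (a f : ℝ) (b c d e g : ℂ) : Matrix (Fin 4) (Fin 4) ℂ :=
  !![1, b / a, c / a, d / a;
     0, 1, (a * e - star b * c) / det₂ a (1 - a) b, (-a * c - star b * d) / det₂ a (1 - a) b;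
     0, 0, 1, offMinor a b c d e g / det₃ a f b c e;
     0, 0, 0, 1]

/-- The diagonal factor of the Choi matrix. -/
noncomputable def pivots (a f : ℝ) (b c d e g : ℂ) : Fin 4 → ℝ :=
  ![a, det₂ a (1 - a) b / a, det₃ a f b c e / det₂ a (1 - a) b,
    (det₃ a f b c e * det₃ (1 - a) (1 - f) (star b) (-c) d
      - Complex.normSq (offMinor a b c d e g)) / (det₂ a (1 - a) b * det₃ a f b c e)]

lemma ofReal_det₂ (p q : ℝ) (c : ℂ) : ((det₂ p q c : ℝ) : ℂ) = p * q - c * star c := by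
  simp [det₂, Complex.mul_conj]

lemma ofReal_det₃ (a f : ℝ) (b c e : ℂ) : ((det₃ a f b c e : ℝ) : ℂ) =
    a * (1 - a) * f + b * e * star c + star b * star e * c - a * (e * star e)
    - (1 - a) * (c * star c) - f * (b * star b) := by
  apply Complex.ext <;> simp [det₃, Complex.normSq_apply] <;> ring

lemma choiMat_eq (a f : ℝ) (b c d e g : ℂ) (ha : a ≠ 0) (h₂ : det₂ a (1 - a) b ≠ 0)
    (h₃ : det₃ a f b c e ≠ 0) :
    choiMat a f b c d e g = star (triFactor a f b c d e g) *
      Matrix.diagonal (fun i => (pivots a f b c d e g i : ℂ)) * triFactor a f b c d e g := by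
  have ha' : (a : ℂ) ≠ 0 := by exact_mod_cast ha
  have h₂' : (det₂ a (1 - a) b : ℂ) ≠ 0 := by exact_mod_cast h₂
  have h₃' : (det₃ a f b c e : ℂ) ≠ 0 := by exact_mod_cast h₃
  have e2 := ofReal_det₂ a (1 - a) b
  have e3 := ofReal_det₃ a f b c e
  have e4 := ofReal_det₃ (1 - a) (1 - f) (star b) (-c) d
  simp only [Complex.ofReal_sub, Complex.ofReal_one, ← starRingEnd_apply, map_neg,
    Complex.conj_conj] at e2 e3 e4
  ext i j
  fin_cases i <;> fin_cases j <;>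
    simp [choiMat, triFactor, pivots, Matrix.mul_apply, Fin.sum_univ_four, Matrix.diagonal_apply,
      Complex.normSq_eq_conj_mul_self] <;> field_simp <;>
    first
    | ring1
    | (simp only [e2, e3, e4]; ring1)
    | (simp [offMinor, e2]; ring1)

lemma isUnit_triFactor (a f : ℝ) (b c d e g : ℂ) : IsUnit (triFactor a f b c d e g) := by
  rw [Matrix.isUnit_iff_isUnit_det]
  have : (triFactor a f b c d e g).det = 1 := by
    rw [Matrix.det_of_isUpperTriangular]
    · simp [triFactor, Fin.prod_univ_four]
    · intro i j h
      fin_cases i <;> fin_cases j <;> simp_all [triFactor]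
  simp [this]

lemma mul_det₃ (a f : ℝ) (b c e : ℂ) :
    a * det₃ a f b c e = det₂ a (1 - a) b * det₂ a f c - Complex.normSq (a * e - star b * c) := by
  simp [det₃, det₂, Complex.normSq_apply]
  ring

/-- The conditions on the parameters that make the Choi matrix positive definite, in a form adapted
to integrating over `g, e, d, c, b, f, a` in this order. -/
def Feasible (a f : ℝ) (b c d e g : ℂ) : Prop :=
  0 < a ∧ a < 1 ∧ 0 < det₂ a (1 - a) b ∧ 0 < det₂ a f c ∧ 0 < det₂ (1 - a) (1 - f) c ∧
    0 < det₃ a f b c e ∧ 0 < det₃ (1 - a) (1 - f) (star b) (-c) d ∧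
    Complex.normSq (offMinor a b c d e g) <
      det₃ a f b c e * det₃ (1 - a) (1 - f) (star b) (-c) d

lemma posDef_choiMat_iff (a f : ℝ) (b c d e g : ℂ) :
    (choiMat a f b c d e g).PosDef ↔ Feasible a f b c d e g := by
  have key (h₁ : 0 < a) (h₂ : 0 < det₂ a (1 - a) b) (h₃ : 0 < det₃ a f b c e) :
      (choiMat a f b c d e g).PosDef ↔ ∀ i, 0 < pivots a f b c d e g i := by
    rw [choiMat_eq a f b c d e g h₁.ne' h₂.ne' h₃.ne',
      (isUnit_triFactor a f b c d e g).posDef_star_left_conjugate_iff, Matrix.posDef_diagonal_iff]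
    simp
  constructor
  · intro h
    have h₀ := h.diag_pos (i := 0)
    have h₁ := h.diag_pos (i := 1)
    have h01 := (h.submatrix (e := ![0, 1]) (by decide)).det_pos
    have h02 := (h.submatrix (e := ![0, 2]) (by decide)).det_pos
    have h13 := (h.submatrix (e := ![1, 3]) (by decide)).det_pos
    have h012 := (h.submatrix (e := ![0, 1, 2]) (by decide)).det_pos
    have h103 := (h.submatrix (e := ![1, 0, 3]) (by decide)).det_pos
    rw [Matrix.det_fin_two] at h01 h02 h13
    rw [Matrix.det_fin_three] at h012 h103
    simp [choiMat] at h₀ h₁ h01 h02 h13 h012 h103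
    have k01 : 0 < det₂ a (1 - a) b := by
      rw [← Complex.zero_lt_real, ofReal_det₂]; simpa using h01
    have k02 : 0 < det₂ a f c := by
      rw [← Complex.zero_lt_real, ofReal_det₂]; simpa using h02
    have k13 : 0 < det₂ (1 - a) (1 - f) c := by
      rw [← Complex.zero_lt_real, ofReal_det₂]; simpa using h13
    have k012 : 0 < det₃ a f b c e := by
      rw [← Complex.zero_lt_real, ofReal_det₃]; convert sub_pos.2 h012 using 1; simp; ring
    have k103 : 0 < det₃ (1 - a) (1 - f) (star b) (-c) d := by
      rw [← Complex.zero_lt_real, ofReal_det₃]; convert sub_pos.2 h103 using 1; simp; ring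
    have h3 := (key h₀ k01 k012).1 h 3
    refine ⟨h₀, by exact_mod_cast h₁, k01, k02, k13, k012, k103, ?_⟩
    exact sub_pos.1 ((div_pos_iff_of_pos_right (mul_pos k01 k012)).1 h3)
  · rintro ⟨h₀, h₁, h01, h02, h13, h012, h103, h⟩
    rw [key h₀ h01 h012]
    intro i
    fin_cases i
    · exact h₀
    · exact div_pos h01 h₀
    · exact div_pos h012 h01
    · exact div_pos (sub_pos.2 h) (mul_pos h01 h012)

/-- The Choi matrix as a function on the parameter space. -/
noncomputable def choi (p : ℝ × ℝ × ℂ × ℂ × ℂ × ℂ × ℂ) : Matrix (Fin 4) (Fin 4) ℂ :=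
  choiMat p.1 p.2.1 p.2.2.1 p.2.2.2.1 p.2.2.2.2.1 p.2.2.2.2.2.1 p.2.2.2.2.2.2

lemma choi_convexComb (p q : ℝ × ℝ × ℂ × ℂ × ℂ × ℂ × ℂ) {s t : ℝ} (h : s + t = 1) :
    choi (s • p + t • q) = s • choi p + t • choi q := by
  obtain rfl : s = 1 - t := by linarith
  ext i j
  fin_cases i <;> fin_cases j <;> simp [choi, choiMat] <;> ring

/-- The set of parameters with positive definite Choi matrix. -/
def feasibleSet : Set (ℝ × ℝ × ℂ × ℂ × ℂ × ℂ × ℂ) :=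
  {p | Feasible p.1 p.2.1 p.2.2.1 p.2.2.2.1 p.2.2.2.2.1 p.2.2.2.2.2.1 p.2.2.2.2.2.2}

lemma mem_feasibleSet {p : ℝ × ℝ × ℂ × ℂ × ℂ × ℂ × ℂ} :
    p ∈ feasibleSet ↔ (choi p).PosDef :=
  (posDef_choiMat_iff _ _ _ _ _ _ _).symm

lemma convex_feasibleSet : Convex ℝ feasibleSet := by
  rw [convex_iff_forall_pos]
  intro p hp q hq s t hs ht hst
  rw [mem_feasibleSet] at *
  rw [choi_convexComb p q hst]
  exact (hp.smul hs).add (hq.smul ht)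

lemma isOpen_feasibleSet : IsOpen feasibleSet := by
  simp only [feasibleSet, Feasible, Set.ofPred_and]
  refine IsOpen.inter ?_ <| IsOpen.inter ?_ <| IsOpen.inter ?_ <| IsOpen.inter ?_ <|
    IsOpen.inter ?_ <| IsOpen.inter ?_ <| IsOpen.inter ?_ ?_
  all_goals
    refine isOpen_lt ?_ ?_ <;>
      (try simp only [det₂, det₃, offMinor, Complex.normSq_apply]) <;> fun_prop

lemma posSemidef_subset_closure : {p | (choi p).PosSemidef} ⊆ closure feasibleSet := by
  intro p hp
  let q : ℝ × ℝ × ℂ × ℂ × ℂ × ℂ × ℂ := (1 / 2, 1 / 2, 0, 0, 0, 0, 0)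
  have hq : (choi q).PosDef := by
    have : choi q = (1 / 2 : ℝ) • (1 : Matrix (Fin 4) (Fin 4) ℂ) := by
      ext i j
      fin_cases i <;> fin_cases j <;> simp [q, choi, choiMat] <;> norm_num
    rw [this]
    exact Matrix.PosDef.one.smul (by norm_num)
  have hsub : openSegment ℝ p q ⊆ feasibleSet := by
    rintro _ ⟨s, t, hs, ht, hst, rfl⟩
    rw [mem_feasibleSet, choi_convexComb p q hst]
    exact Matrix.PosDef.posSemidef_add (Matrix.PosSemidef.smul hp hs.le) (hq.smul ht)
  refine closure_mono hsub ?_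
  rw [closure_openSegment]
  exact left_mem_segment ℝ p q

lemma isAddHaarMeasure_volume_prod (E F : Type*) [NormedAddCommGroup E] [MeasureSpace E]
    [BorelSpace E] [SecondCountableTopology E] [NormedAddCommGroup F] [MeasureSpace F]
    [BorelSpace F] [SecondCountableTopology F] [SFinite (volume : Measure E)]
    [SFinite (volume : Measure F)] [(volume : Measure E).IsAddHaarMeasure]
    [(volume : Measure F).IsAddHaarMeasure] :
    (volume : Measure (E × F)).IsAddHaarMeasure :=
  Measure.prod.instIsAddHaarMeasure volume volume

lemma volume_frontier_of_convex {s : Set (ℝ × ℝ × ℂ × ℂ × ℂ × ℂ × ℂ)} (hs : Convex ℝ s) :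
    volume (frontier s) = 0 := by
  have := isAddHaarMeasure_volume_prod ℂ ℂ
  have := isAddHaarMeasure_volume_prod ℂ (ℂ × ℂ)
  have := isAddHaarMeasure_volume_prod ℂ (ℂ × ℂ × ℂ)
  have := isAddHaarMeasure_volume_prod ℂ (ℂ × ℂ × ℂ × ℂ)
  have b : BorelSpace (ℂ × ℂ × ℂ × ℂ × ℂ) := inferInstance
  have := @isAddHaarMeasure_volume_prod ℝ (ℂ × ℂ × ℂ × ℂ × ℂ) _ _ _ _ _ _ b _ _ _ _ _
  have b : BorelSpace (ℝ × ℂ × ℂ × ℂ × ℂ × ℂ) := inferInstance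
  have := @isAddHaarMeasure_volume_prod ℝ (ℝ × ℂ × ℂ × ℂ × ℂ × ℂ) _ _ _ _ _ _ b _ _ _ _ _
  have b : BorelSpace (ℝ × ℝ × ℂ × ℂ × ℂ × ℂ × ℂ) := inferInstance
  exact @Convex.addHaar_frontier _ _ _ _ b _ volume this s hs

/-- Up to a null set, positive semidefinite Choi matrices are positive definite. -/
lemma volume_posSemidef_eq :
    volume {p : ℝ × ℝ × ℂ × ℂ × ℂ × ℂ × ℂ |
        p.1 ∈ Set.Icc (0 : ℝ) 1 ∧ p.2.1 ∈ Set.Icc (0 : ℝ) 1 ∧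
        (choiMat p.1 p.2.1 p.2.2.1 p.2.2.2.1 p.2.2.2.2.1 p.2.2.2.2.2.1
          p.2.2.2.2.2.2).PosSemidef} = volume feasibleSet := by
  apply le_antisymm
  · rw [← measure_closure_of_null_frontier (volume_frontier_of_convex convex_feasibleSet)]
    exact measure_mono fun p hp => posSemidef_subset_closure hp.2.2
  · refine measure_mono fun p hp => ?_
    obtain ⟨h0, h1, -, h02, h13, -⟩ := id hp
    refine ⟨⟨h0.le, h1.le⟩, ⟨?_, ?_⟩, (mem_feasibleSet.1 hp).posSemidef⟩
    · have := Complex.normSq_nonneg p.2.2.2.1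
      simp only [det₂] at h02
      nlinarith
    · have := Complex.normSq_nonneg p.2.2.2.1
      simp only [det₂] at h13
      nlinarith

lemma setLIntegral_Ioc_of_hasDerivAt {l u : ℝ} (h : l ≤ u) {F : ℝ → ENNReal} {p P : ℝ → ℝ}
    (hF : ∀ t ∈ Set.Ioc l u, F t = ENNReal.ofReal (p t)) (hp : ∀ t ∈ Set.Ioc l u, 0 ≤ p t)
    (hc : Continuous p) (hP : ∀ t, HasDerivAt P (p t) t) :
    ∫⁻ t in Set.Ioc l u, F t = ENNReal.ofReal (P u - P l) := by
  rw [setLIntegral_congr_fun measurableSet_Ioc hF,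
    ← ofReal_integral_eq_lintegral_ofReal hc.integrableOn_Ioc
      ((ae_restrict_iff' measurableSet_Ioc).2 (.of_forall hp)),
    ← intervalIntegral.integral_of_le h,
    intervalIntegral.integral_eq_sub_of_hasDerivAt (fun t _ => hP t) (hc.intervalIntegrable _ _)]

lemma setLIntegral_Ioi_eq_Ioc {l u : ℝ} (h : l ≤ u) {F : ℝ → ENNReal} (hF : ∀ t, u < t → F t = 0) :
    ∫⁻ t in Set.Ioi l, F t = ∫⁻ t in Set.Ioc l u, F t := by
  rw [← Set.Ioc_union_Ioi_eq_Ioi h, lintegral_union measurableSet_Ioi (Set.Ioc_disjoint_Ioi le_rfl),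
    setLIntegral_congr_fun measurableSet_Ioi hF]
  simp

/-- Integrating a function of the squared modulus over `ℂ` in polar coordinates. -/
lemma lintegral_comp_normSq {F : ℝ → ENNReal} (hF : Measurable F) {k : ℝ} (hk : 0 < k) (w : ℂ) :
    ∫⁻ z : ℂ, F (Complex.normSq (k * z - w)) =
      ENNReal.ofReal (π / k ^ 2) * ∫⁻ t in Set.Ioi 0, F t := by
  have hk' : (k : ℂ) ≠ 0 := by exact_mod_cast hk.ne'
  have h1 (z : ℂ) : Complex.normSq (k * z - w) = k ^ 2 * Complex.normSq (z - w / k) := by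
    rw [show (k : ℂ) * z - w = k * (z - w / k) by field_simp, map_mul, Complex.normSq_ofReal, sq]
  simp_rw [h1]
  rw [lintegral_sub_right_eq_self (fun z => F (k ^ 2 * Complex.normSq z)),
    ← Complex.lintegral_comp_polarCoord_symm]
  have h2 : ∫⁻ t in Set.Ioi 0, F t =
      ∫⁻ r in Set.Ioi 0, ENNReal.ofReal (2 * k ^ 2 * r) * F (k ^ 2 * r ^ 2) := by
    have himg : (fun r : ℝ => k ^ 2 * r ^ 2) '' Set.Ioi 0 = Set.Ioi 0 := by
      ext t
      constructor
      · rintro ⟨r, hr, rfl⟩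
        have : 0 < r := hr
        exact Set.mem_Ioi.2 (by positivity)
      · intro ht
        have : 0 < t := ht
        refine ⟨√t / k, Set.mem_Ioi.2 (by positivity), ?_⟩
        simp only [div_pow, Real.sq_sqrt this.le]
        field_simp
    conv_lhs => rw [← himg]
    rw [lintegral_image_eq_lintegral_abs_deriv_mul measurableSet_Ioi
      (f' := fun r => 2 * k ^ 2 * r)]
    · refine setLIntegral_congr_fun measurableSet_Ioi fun r hr => ?_
      have : 0 < r := hr
      simp only [abs_of_pos (show 0 < 2 * k ^ 2 * r by positivity)]
    · intro r _
      refine (((hasDerivAt_pow 2 r).const_mul (k ^ 2)).congr_deriv ?_).hasDerivWithinAt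
      simp; ring
    · intro r hr s hs h
      have hr' : 0 < r := hr
      have hs' : 0 < s := hs
      simp only [mul_eq_mul_left_iff, pow_eq_zero_iff, ne_eq, OfNat.ofNat_ne_zero,
        not_false_eq_true, hk.ne', or_false] at h
      exact (pow_left_inj₀ hr'.le hs'.le two_ne_zero).1 h
  have h3 (q : ℝ × ℝ) : Complex.normSq (Complex.polarCoord.symm q) = q.1 ^ 2 := by
    rw [Complex.normSq_eq_norm_sq, Complex.norm_polarCoord_symm, sq_abs]
  simp_rw [h3, smul_eq_mul, polarCoord_target]
  rw [Measure.volume_eq_prod, ← Measure.prod_restrict, lintegral_prod _ (by fun_prop), h2]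
  simp only [lintegral_const, Measure.restrict_apply_univ, Real.volume_Ioo, sub_neg_eq_add]
  rw [lintegral_mul_const _ (by fun_prop), mul_comm, ← lintegral_const_mul _ (by fun_prop),
    ← lintegral_const_mul _ (by fun_prop)]
  refine setLIntegral_congr_fun measurableSet_Ioi fun r hr => ?_
  have : 0 < r := hr
  simp only [← mul_assoc]
  rw [← ENNReal.ofReal_mul (by positivity), ← ENNReal.ofReal_mul (by positivity)]
  congr 2
  field_simp
  ring

lemma lintegral_det₃ {a : ℝ} (ha : 0 < a) (f : ℝ) (b c : ℂ) (h₁ : 0 < det₂ a (1 - a) b)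
    (h₂ : 0 < det₂ a f c) :
    ∫⁻ e, ENNReal.ofReal (det₃ a f b c e) =
      ENNReal.ofReal (π / (2 * a ^ 3) * (det₂ a (1 - a) b * det₂ a f c) ^ 2) := by
  set P := det₂ a (1 - a) b * det₂ a f c with hPdef
  have hP : 0 < P := mul_pos h₁ h₂
  have h (e : ℂ) : det₃ a f b c e = (P - Complex.normSq (a * e - star b * c)) / a := by
    rw [hPdef, ← mul_det₃]; field_simp
  simp_rw [h]
  rw [lintegral_comp_normSq (F := fun t => ENNReal.ofReal ((P - t) / a)) (by fun_prop) ha,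
    setLIntegral_Ioi_eq_Ioc hP.le,
    setLIntegral_Ioc_of_hasDerivAt (p := fun t => (P - t) / a) (P := fun t => -(P - t) ^ 2 / (2 * a))
      hP.le (fun _ _ => rfl) (fun t ht => div_nonneg (sub_nonneg.2 ht.2) ha.le) (by fun_prop),
    ← ENNReal.ofReal_mul (by positivity)]
  · congr 1
    field_simp
    ring
  · intro t
    refine ((((hasDerivAt_id t).const_sub P).pow 2).neg.div_const (2 * a)).congr_deriv ?_
    simp; field_simp
  · intro t ht
    exact ENNReal.ofReal_of_nonpos (div_nonpos_of_nonpos_of_nonneg (by linarith) ha.le)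

lemma lintegral_sq_det₂ {a : ℝ} (ha : 0 < a) (ha' : a < 1) :
    ∫⁻ b, ENNReal.ofReal (det₂ a (1 - a) b) ^ 2 =
      ENNReal.ofReal (π * (a * (1 - a)) ^ 3 / 3) := by
  have hR : 0 < a * (1 - a) := mul_pos ha (sub_pos.2 ha')
  have h := lintegral_comp_normSq (F := fun t => ENNReal.ofReal (a * (1 - a) - t) ^ 2)
    (by fun_prop) one_pos 0
  simp only [Complex.ofReal_one, one_mul, sub_zero] at h
  simp only [det₂]
  rw [h, setLIntegral_Ioi_eq_Ioc hR.le,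
    setLIntegral_Ioc_of_hasDerivAt (p := fun t => (a * (1 - a) - t) ^ 2)
      (P := fun t => -(a * (1 - a) - t) ^ 3 / 3) hR.le
      (fun t ht => (ENNReal.ofReal_pow (sub_nonneg.2 ht.2) 2).symm)
      (fun t ht => sq_nonneg _) (by fun_prop),
    ← ENNReal.ofReal_mul (by positivity)]
  · congr 1
    ring
  · intro t
    refine ((((hasDerivAt_id t).const_sub (a * (1 - a))).pow 3).neg.div_const 3).congr_deriv ?_
    simp
  · intro t ht
    simp [ENNReal.ofReal_of_nonpos (show a * (1 - a) - t ≤ 0 by linarith)]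

lemma volume_offMinor_lt {a : ℝ} {b : ℂ} (h : 0 < det₂ a (1 - a) b) (c d e : ℂ) (R : ℝ) :
    volume {g : ℂ | Complex.normSq (offMinor a b c d e g) < R} =
      ENNReal.ofReal (π / det₂ a (1 - a) b ^ 2 * R) := by
  have hm : MeasurableSet {g : ℂ | Complex.normSq (offMinor a b c d e g) < R} := by
    refine (isOpen_lt ?_ continuous_const).measurableSet
    simp only [offMinor, Complex.normSq_apply]
    fun_prop
  rw [← lintegral_indicator_one hm]
  trans ∫⁻ g : ℂ, (Set.Iio R).indicator (1 : ℝ → ENNReal)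
      (Complex.normSq (offMinor a b c d e g))
  · rfl
  · simp only [offMinor]
    rw [lintegral_comp_normSq (measurable_one.indicator measurableSet_Iio) h,
      lintegral_indicator measurableSet_Iio, ENNReal.ofReal_mul (by positivity)]
    simp [Measure.restrict_restrict measurableSet_Iio, Set.inter_comm (Set.Iio R),
      Set.Ioi_inter_Iio]

lemma volume_feasible_of_pos {a f : ℝ} {b c : ℂ} (ha : 0 < a) (ha' : a < 1)
    (h₁ : 0 < det₂ a (1 - a) b) (h₂ : 0 < det₂ a f c) (h₃ : 0 < det₂ (1 - a) (1 - f) c) (d e : ℂ) :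
    volume {g | Feasible a f b c d e g} = ENNReal.ofReal (π / det₂ a (1 - a) b ^ 2) *
      ENNReal.ofReal (det₃ (1 - a) (1 - f) (star b) (-c) d) * ENNReal.ofReal (det₃ a f b c e) := by
  simp only [Feasible, ha, ha', h₁, h₂, h₃, true_and]
  by_cases he : 0 < det₃ a f b c e
  · by_cases hd : 0 < det₃ (1 - a) (1 - f) (star b) (-c) d
    · simp only [he, hd, true_and]
      rw [volume_offMinor_lt h₁, ← ENNReal.ofReal_mul (by positivity),
        ← ENNReal.ofReal_mul (by positivity)]
      congr 1
      ring
    · rw [ENNReal.ofReal_of_nonpos (not_lt.1 hd)]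
      simp only [hd, false_and, and_false]
      simp
  · simp [ENNReal.ofReal_of_nonpos (not_lt.1 he), he]

lemma lintegral_volume_feasible {a : ℝ} (ha : 0 < a) (ha' : a < 1) (f : ℝ) (b c : ℂ) :
    ∫⁻ d, ∫⁻ e, volume {g | Feasible a f b c d e g} =
      ENNReal.ofReal (π ^ 3 / (4 * (a * (1 - a)) ^ 3)) * (ENNReal.ofReal (det₂ a (1 - a) b) ^ 2 *
        (ENNReal.ofReal (det₂ a f c) ^ 2 * ENNReal.ofReal (det₂ (1 - a) (1 - f) c) ^ 2)) := by
  by_cases h₁ : 0 < det₂ a (1 - a) b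
  swap
  · simp [Feasible, h₁, ENNReal.ofReal_of_nonpos (not_lt.1 h₁)]
  by_cases h₂ : 0 < det₂ a f c
  swap
  · simp [Feasible, h₂, ENNReal.ofReal_of_nonpos (not_lt.1 h₂)]
  by_cases h₃ : 0 < det₂ (1 - a) (1 - f) c
  swap
  · simp [Feasible, h₃, ENNReal.ofReal_of_nonpos (not_lt.1 h₃)]
  have h₁' : det₂ (1 - a) (1 - (1 - a)) (star b) = det₂ a (1 - a) b := by
    simp [det₂, mul_comm]
  have h₃' : det₂ (1 - a) (1 - f) (-c) = det₂ (1 - a) (1 - f) c := by simp [det₂]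
  have ha1 : 0 < 1 - a := sub_pos.2 ha'
  simp_rw [volume_feasible_of_pos ha ha' h₁ h₂ h₃]
  simp_rw [lintegral_const_mul' _ _ (ENNReal.mul_ne_top ENNReal.ofReal_ne_top ENNReal.ofReal_ne_top)]
  rw [lintegral_det₃ ha f b c h₁ h₂, lintegral_mul_const' _ _ ENNReal.ofReal_ne_top,
    lintegral_const_mul' _ _ ENNReal.ofReal_ne_top,
    lintegral_det₃ ha1 _ _ _ (h₁' ▸ h₁) (h₃' ▸ h₃), h₁', h₃']
  simp only [← ENNReal.ofReal_pow h₁.le, ← ENNReal.ofReal_pow h₂.le, ← ENNReal.ofReal_pow h₃.le]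
  repeat rw [← ENNReal.ofReal_mul (by positivity)]
  congr 1
  field_simp
  ring

/-- The integral of `det P ^ 2 * det (1 - P) ^ 2` over the squared modulus `t` of the off-diagonal
entry of the positive contraction `P` with diagonal `(a, f)`. -/
noncomputable def radial (a f : ℝ) : ENNReal :=
  ∫⁻ t in Set.Ioi 0, ENNReal.ofReal (a * f - t) ^ 2 * ENNReal.ofReal ((1 - a) * (1 - f) - t) ^ 2

lemma lintegral_volume_feasible_eq_radial {a : ℝ} (ha : 0 < a) (ha' : a < 1) (f : ℝ) :
    ∫⁻ b, ∫⁻ c, ∫⁻ d, ∫⁻ e, volume {g | Feasible a f b c d e g} =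
      ENNReal.ofReal (π ^ 5 / 12) * radial a f := by
  have ha1 : 0 < 1 - a := sub_pos.2 ha'
  have h := lintegral_comp_normSq (F := fun t => ENNReal.ofReal (a * f - t) ^ 2 *
    ENNReal.ofReal ((1 - a) * (1 - f) - t) ^ 2) (by fun_prop) one_pos 0
  simp only [Complex.ofReal_one, one_mul, sub_zero, one_pow, div_one] at h
  have hm : Measurable fun b => ENNReal.ofReal (det₂ a (1 - a) b) ^ 2 := by
    simp only [det₂, Complex.normSq_apply]
    fun_prop
  simp_rw [lintegral_volume_feasible ha ha', lintegral_const_mul' _ _ ENNReal.ofReal_ne_top,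
    lintegral_const_mul' _ _ (ENNReal.pow_ne_top ENNReal.ofReal_ne_top)]
  rw [lintegral_mul_const _ hm, lintegral_sq_det₂ ha ha']
  simp only [det₂]
  rw [h, radial, ← mul_assoc, ← mul_assoc, ← ENNReal.ofReal_mul (by positivity),
    ← ENNReal.ofReal_mul (by positivity)]
  congr 2
  field_simp
  ring

lemma radial_symm (a f : ℝ) : radial (1 - a) (1 - f) = radial a f := by
  simp only [radial, sub_sub_cancel, mul_comm]

lemma radial_eq_zero {a f : ℝ} (ha : 0 < a) (hf : f ≤ 0) : radial a f = 0 := by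
  rw [radial, setLIntegral_congr_fun (g := fun _ => 0) measurableSet_Ioi]
  · simp
  · intro t ht
    have : a * f - t ≤ 0 := by
      have := mul_nonneg ha.le (neg_nonneg.2 hf)
      have : 0 < t := ht
      linarith
    simp [ENNReal.ofReal_of_nonpos this]

/-- The value of `radial a f` for `0 ≤ f ≤ 1 - a`. -/
noncomputable def radialPoly (a f : ℝ) : ℝ :=
  (a * f) ^ 5 / 5 + (1 - a - f) * (a * f) ^ 4 / 2 + (1 - a - f) ^ 2 * (a * f) ^ 3 / 3

lemma radial_eq {a f : ℝ} (ha : 0 < a) (hf : 0 < f) (h : f ≤ 1 - a) :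
    radial a f = ENNReal.ofReal (radialPoly a f) := by
  rw [radialPoly]
  have hm : 0 < a * f := mul_pos ha hf
  have hs : 0 ≤ 1 - a - f := by linarith
  generalize hsd : 1 - a - f = s at hs
  have hr : (1 - a) * (1 - f) = a * f + s := by rw [← hsd]; ring
  rw [radial, hr]
  generalize a * f = m at hm
  rw [setLIntegral_Ioi_eq_Ioc hm.le, setLIntegral_Ioc_of_hasDerivAt hm.le
    (p := fun t => (m - t) ^ 2 * (m + s - t) ^ 2)
    (P := fun t => -((m - t) ^ 5 / 5 + s * (m - t) ^ 4 / 2 + s ^ 2 * (m - t) ^ 3 / 3))]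
  · congr 1
    ring
  · intro t ht
    rw [← ENNReal.ofReal_pow (sub_nonneg.2 ht.2), ← ENNReal.ofReal_pow (by linarith [ht.2]),
      ← ENNReal.ofReal_mul (by positivity)]
  · intro t _
    positivity
  · fun_prop
  · intro t
    have h := (hasDerivAt_id t).const_sub m
    refine ((((h.pow 5).div_const 5).add (((h.pow 4).const_mul s).div_const 2)).add
      (((h.pow 3).const_mul (s ^ 2)).div_const 3)).neg.congr_deriv ?_
    simp
    ring
  · intro t ht
    simp [ENNReal.ofReal_of_nonpos (show m - t ≤ 0 by linarith)]

/-- The integral of `radial a` over `[0, 1 - a]`. -/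
noncomputable def triangle (a : ℝ) : ℝ := (1 - a) ^ 6 * (a ^ 5 / 30 + a ^ 4 / 60 + a ^ 3 / 180)

/-- An antiderivative of `radialPoly a`. -/
noncomputable def radialPrim (a f : ℝ) : ℝ :=
  a ^ 5 / 30 * f ^ 6 + a ^ 4 / 2 * ((1 - a) / 5 * f ^ 5 - 1 / 6 * f ^ 6)
    + a ^ 3 / 3 * ((1 - a) ^ 2 / 4 * f ^ 4 - 2 * (1 - a) / 5 * f ^ 5 + 1 / 6 * f ^ 6)

lemma hasDerivAt_radialPrim (a f : ℝ) : HasDerivAt (radialPrim a) (radialPoly a f) f := by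
  have h (n : ℕ) := hasDerivAt_pow n f
  refine ((((h 6).const_mul _).add ((((h 5).const_mul _).sub ((h 6).const_mul _)).const_mul _)).add
    (((((h 4).const_mul _).sub ((h 5).const_mul _)).add ((h 6).const_mul _)).const_mul
      _)).congr_deriv ?_
  simp [radialPoly]
  ring

lemma radialPoly_nonneg {a f : ℝ} (ha : 0 < a) (hf : 0 ≤ f) (h : f ≤ 1 - a) :
    0 ≤ radialPoly a f := by
  have hs : 0 ≤ 1 - a - f := by linarith
  unfold radialPoly
  positivity

lemma lintegral_radial {a : ℝ} (ha : 0 < a) (ha' : a < 1) :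
    ∫⁻ f, radial a f = ENNReal.ofReal (triangle a + triangle (1 - a)) := by
  have ha1 : 0 < 1 - a := sub_pos.2 ha'
  have hsupp : (Set.Ioc 0 1).indicator (radial a) = radial a := by
    refine Set.indicator_eq_self.2 fun f hf => ?_
    by_contra hf'
    refine hf ?_
    by_cases h0 : f ≤ 0
    · exact radial_eq_zero ha h0
    · rw [← radial_symm]
      refine radial_eq_zero ha1 ?_
      by_contra h1
      exact hf' ⟨not_le.1 h0, by linarith⟩
  rw [← hsupp, lintegral_indicator measurableSet_Ioc,
    ← Set.Ioc_union_Ioc_eq_Ioc ha1.le (by linarith : 1 - a ≤ 1),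
    lintegral_union measurableSet_Ioc (Set.Ioc_disjoint_Ioc_of_le le_rfl),
    setLIntegral_Ioc_of_hasDerivAt (p := radialPoly a) (P := radialPrim a) ha1.le
      (fun f hf => radial_eq ha hf.1 hf.2) (fun f hf => radialPoly_nonneg ha hf.1.le hf.2)
      (by unfold radialPoly; fun_prop) (hasDerivAt_radialPrim a),
    setLIntegral_Ioc_of_hasDerivAt (p := fun f => radialPoly (1 - a) (1 - f))
      (P := fun f => -radialPrim (1 - a) (1 - f)) (by linarith),
    ← ENNReal.ofReal_add]
  · congr 1
    simp only [radialPrim, triangle]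
    ring
  · have : radialPrim a (1 - a) - radialPrim a 0 = triangle a := by
      simp only [radialPrim, triangle]
      ring
    rw [this, triangle]
    positivity
  · have : -radialPrim (1 - a) (1 - 1) - -radialPrim (1 - a) (1 - (1 - a)) = triangle (1 - a) := by
      simp only [radialPrim, triangle]
      ring
    rw [this, triangle]
    positivity
  · rintro f ⟨hf, hf'⟩
    rw [← radial_symm]
    obtain rfl | hf1 := hf'.eq_or_lt
    · rw [radial_eq_zero ha1 (by simp)]
      simp [radialPoly]
    · exact radial_eq ha1 (by linarith) (by linarith)
  · rintro f ⟨hf, hf'⟩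
    exact radialPoly_nonneg ha1 (by linarith) (by linarith)
  · unfold radialPoly
    fun_prop
  · intro f
    exact ((hasDerivAt_radialPrim (1 - a) (1 - f)).comp f
      ((hasDerivAt_id f).const_sub 1)).neg.congr_deriv (by simp)

lemma setLIntegral_triangle :
    ∫⁻ a in Set.Ioo 0 1, ENNReal.ofReal (triangle a + triangle (1 - a)) =
      ENNReal.ofReal (1 / 25200) := by
  let Q : ℝ → ℝ := fun x => 1 / 126 * x ^ 7 - 1 / 32 * x ^ 8 + 1 / 20 * x ^ 9 - 73 / 1800 * x ^ 10
    + 1 / 60 * x ^ 11 - 1 / 360 * x ^ 12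
  have hQ (x : ℝ) : HasDerivAt Q (triangle (1 - x)) x := by
    have h (n : ℕ) := hasDerivAt_pow n x
    refine (((((((h 7).const_mul _).sub ((h 8).const_mul _)).add ((h 9).const_mul _)).sub
      ((h 10).const_mul _)).add ((h 11).const_mul _)).sub ((h 12).const_mul _)).congr_deriv ?_
    simp [triangle]
    ring
  rw [Measure.restrict_congr_set Ioo_ae_eq_Ioc,
    setLIntegral_Ioc_of_hasDerivAt (p := fun a => triangle a + triangle (1 - a))
      (P := fun a => -Q (1 - a) + Q a) zero_le_one (fun _ _ => rfl)]
  · congr 1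
    simp only [Q]
    norm_num
  · rintro a ⟨h0, h1⟩
    have : 0 ≤ 1 - a := by linarith
    simp only [triangle, sub_sub_cancel]
    positivity
  · unfold triangle; fun_prop
  · intro a
    have h := (hQ (1 - a)).comp a ((hasDerivAt_id a).const_sub 1)
    refine (h.neg.add (hQ a)).congr_deriv ?_
    simp

lemma volume_eq_lintegral_slice {E F : Type*} [MeasureSpace E] [MeasureSpace F]
    [SFinite (volume : Measure F)] {s : Set (E × F)} (hs : MeasurableSet s) :
    volume s = ∫⁻ x, volume {y | (x, y) ∈ s} :=
  Measure.prod_apply hs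

lemma volume_feasibleSet_eq_lintegral : volume feasibleSet =
    ∫⁻ a, ∫⁻ f, ∫⁻ b, ∫⁻ c, ∫⁻ d, ∫⁻ e, volume {g | Feasible a f b c d e g} := by
  have h := isOpen_feasibleSet.measurableSet
  refine (volume_eq_lintegral_slice h).trans (lintegral_congr fun a => ?_)
  replace h := measurable_prodMk_left (x := a) h
  refine (volume_eq_lintegral_slice h).trans (lintegral_congr fun f => ?_)
  replace h := measurable_prodMk_left (x := f) h
  refine (volume_eq_lintegral_slice h).trans (lintegral_congr fun b => ?_)
  replace h := measurable_prodMk_left (x := b) h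
  refine (volume_eq_lintegral_slice h).trans (lintegral_congr fun c => ?_)
  replace h := measurable_prodMk_left (x := c) h
  refine (volume_eq_lintegral_slice h).trans (lintegral_congr fun d => ?_)
  replace h := measurable_prodMk_left (x := d) h
  exact volume_eq_lintegral_slice h

lemma volume_feasibleSet : volume feasibleSet = ENNReal.ofReal (π ^ 5 / 302400) := by
  have h0 : (Set.Ioo 0 1).indicator (fun a => ∫⁻ f, ∫⁻ b, ∫⁻ c, ∫⁻ d, ∫⁻ e,
      volume {g | Feasible a f b c d e g}) =
      fun a => ∫⁻ f, ∫⁻ b, ∫⁻ c, ∫⁻ d, ∫⁻ e, volume {g | Feasible a f b c d e g} := by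
    refine Set.indicator_eq_self.2 fun a ha => ?_
    by_contra ha'
    refine ha ?_
    have (f : ℝ) (b c d e g : ℂ) : ¬ Feasible a f b c d e g := fun h => ha' ⟨h.1, h.2.1⟩
    simp [this]
  rw [volume_feasibleSet_eq_lintegral, ← h0, lintegral_indicator measurableSet_Ioo,
    setLIntegral_congr_fun (g := fun a => ENNReal.ofReal (π ^ 5 / 12) *
      ENNReal.ofReal (triangle a + triangle (1 - a))) measurableSet_Ioo,
    lintegral_const_mul' _ _ ENNReal.ofReal_ne_top, setLIntegral_triangle,
    ← ENNReal.ofReal_mul (by positivity)]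
  · congr 1
    ring
  · rintro a ⟨ha, ha'⟩
    simp only [lintegral_volume_feasible_eq_radial ha ha']
    rw [lintegral_const_mul' _ _ ENNReal.ofReal_ne_top, lintegral_radial ha ha']

end QubitChannel

/-- The volume of the space of all qubit channels is `2π⁵/4725`: `2⁷` times the
12-dimensional Lebesgue measure of the parameter set
`{(a,f,b,c,d,e,g) ∈ [0,1]² × ℂ⁵ : the Choi matrix is positive semidefinite}`
equals `2π⁵/4725`. -/
theorem volume_qubit_channels :
    2 ^ 7 * volume {p : ℝ × ℝ × ℂ × ℂ × ℂ × ℂ × ℂ |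
        p.1 ∈ Set.Icc (0 : ℝ) 1 ∧ p.2.1 ∈ Set.Icc (0 : ℝ) 1 ∧
        (choiMat p.1 p.2.1 p.2.2.1 p.2.2.2.1 p.2.2.2.2.1 p.2.2.2.2.2.1
          p.2.2.2.2.2.2).PosSemidef}
      = ENNReal.ofReal (2 * π ^ 5 / 4725) := by
  rw [QubitChannel.volume_posSemidef_eq, QubitChannel.volume_feasibleSet,
    show (2 ^ 7 : ENNReal) = ENNReal.ofReal (2 ^ 7) by
      rw [ENNReal.ofReal_pow zero_le_two, ENNReal.ofReal_ofNat],
    ← ENNReal.ofReal_mul (by positivity)]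
  congr 1
  ring
end

section
/- For a ∈ [0,1], define V(a) = 2⁷ times the 8-dimensional Lebesgue measure of the set {(b,c,d,e) ∈ ℂ⁴ : Q¹(a,b,c,d,e) is positive semidefinite}. Then V(a) = (2⁴π⁴/3) · a⁴(1−a)⁴. -/
open MeasureTheory Matrix Real ComplexOrder

/-- The Choi matrix of a unital qubit channel with parameters `(a,b,c,d,e)`. -/
noncomputable def choiMatUnital (a : ℝ) (b c d e : ℂ) : Matrix (Fin 4) (Fin 4) ℂ :=
  !![(a : ℂ), b, c, d;
     star b, 1 - (a : ℂ), e, -c;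
     star c, star e, 1 - (a : ℂ), -b;
     star d, -star c, -star b, (a : ℂ)]

/-- Triples `(c, d, e)` for which the traceless matrix `!![c, d; e, -c]` has operator norm at most
`√D`. -/
def tracelessBall (D : ℝ) : Set (ℂ × ℂ × ℂ) :=
  {x | ‖x.1‖ ^ 2 + (‖x.2.1‖ ^ 2 + ‖x.2.2‖ ^ 2) / 2 ≤ D ∧
    0 ≤ D ^ 2 - 2 * D * (‖x.1‖ ^ 2 + (‖x.2.1‖ ^ 2 + ‖x.2.2‖ ^ 2) / 2) +
      ‖x.1 ^ 2 + x.2.1 * x.2.2‖ ^ 2}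

lemma posSemidef_fin_two_iff (α β : ℝ) (z : ℂ) :
    (!![(α : ℂ), z; star z, (β : ℂ)]).PosSemidef ↔ 0 ≤ α + β ∧ ‖z‖ ^ 2 ≤ α * β := by
  constructor
  · intro h
    have h1 := h.trace_nonneg
    have h2 := h.det_nonneg
    rw [trace_fin_two_of] at h1
    rw [det_fin_two_of, Complex.star_def, Complex.mul_conj, Complex.normSq_eq_norm_sq] at h2
    norm_cast at h1 h2
    exact ⟨h1, by linarith⟩
  · rintro ⟨h1, h2⟩
    refine .of_dotProduct_mulVec_nonneg ?_ fun x => ?_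
    · ext i j
      fin_cases i <;> fin_cases j <;> simp
    · have hα : 0 ≤ α := by nlinarith [sq_nonneg ‖z‖]
      have hβ : 0 ≤ β := by nlinarith [sq_nonneg ‖z‖]
      have key : star x ⬝ᵥ (!![(α : ℂ), z; star z, (β : ℂ)] *ᵥ x) =
          ((α * ‖x 0‖ ^ 2 + β * ‖x 1‖ ^ 2 + 2 * (star (x 0) * z * x 1).re : ℝ) : ℂ) := by
        have hre := Complex.add_conj (star (x 0) * z * x 1)
        push_cast at hre ⊢
        rw [← Complex.mul_conj', ← Complex.mul_conj', ← hre]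
        simp [dotProduct, mulVec, Fin.sum_univ_two]
        ring
      rw [key]
      norm_cast
      have h3 : -(‖x 0‖ * ‖z‖ * ‖x 1‖) ≤ (star (x 0) * z * x 1).re := by
        have := (abs_le.1 (Complex.abs_re_le_norm (star (x 0) * z * x 1))).1
        simpa using this
      have h4 : ‖x 0‖ * ‖z‖ * ‖x 1‖ ≤ √α * ‖x 0‖ * (√β * ‖x 1‖) := by
        have : ‖z‖ ≤ √α * √β := by
          rw [← Real.sqrt_mul hα]; exact Real.le_sqrt_of_sq_le h2
        calc _ = ‖z‖ * (‖x 0‖ * ‖x 1‖) := by ring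
          _ ≤ √α * √β * (‖x 0‖ * ‖x 1‖) := by gcongr
          _ = _ := by ring
      nlinarith [sq_nonneg (√α * ‖x 0‖ - √β * ‖x 1‖), Real.sq_sqrt hα, Real.sq_sqrt hβ]

lemma posSemidef_sub_gram_iff (D : ℝ) (c d e : ℂ) :
    ((D : ℂ) • (1 : Matrix (Fin 2) (Fin 2) ℂ) - (!![c, d; e, -c])ᴴ * !![c, d; e, -c]).PosSemidef ↔
      (c, d, e) ∈ tracelessBall D := by
  have h : (D : ℂ) • (1 : Matrix (Fin 2) (Fin 2) ℂ) - (!![c, d; e, -c])ᴴ * !![c, d; e, -c] =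
      !![((D - ‖c‖ ^ 2 - ‖e‖ ^ 2 : ℝ) : ℂ), star e * c - star c * d;
        star (star e * c - star c * d), ((D - ‖c‖ ^ 2 - ‖d‖ ^ 2 : ℝ) : ℂ)] := by
    push_cast
    simp only [← Complex.mul_conj']
    ext i j
    fin_cases i <;> fin_cases j <;> simp [mul_apply, Fin.sum_univ_two] <;> ring
  have h2 : ‖star e * c - star c * d‖ ^ 2 + ‖c ^ 2 + d * e‖ ^ 2 =
      (‖c‖ ^ 2 + ‖e‖ ^ 2) * (‖c‖ ^ 2 + ‖d‖ ^ 2) := by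
    simp only [← Complex.normSq_eq_norm_sq, Complex.normSq_apply]
    simp [pow_two]
    ring
  rw [h, posSemidef_fin_two_iff]
  simp only [tracelessBall, Set.mem_ofPred_eq]
  constructor
  · rintro ⟨h3, h4⟩
    exact ⟨by linarith, by nlinarith⟩
  · rintro ⟨h3, h4⟩
    exact ⟨by linarith, by nlinarith⟩

lemma choiMatUnital_norm_sq_le {a : ℝ} {b c d e : ℂ} (h : (choiMatUnital a b c d e).PosSemidef) :
    ‖b‖ ^ 2 ≤ a * (1 - a) := by
  have h1 := h.submatrix ![0, 1]
  have h2 : (choiMatUnital a b c d e).submatrix ![0, 1] ![0, 1] =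
      !![(a : ℂ), b; star b, ((1 - a : ℝ) : ℂ)] := by
    ext i j
    fin_cases i <;> fin_cases j <;> simp [choiMatUnital]
  rw [h2, posSemidef_fin_two_iff] at h1
  exact h1.2

lemma choiMatUnital_posSemidef_iff {a w : ℝ} (ha : 0 < a) (hw : 0 < w) {b : ℂ}
    (hb : ‖b‖ ^ 2 + w ^ 2 = a * (1 - a)) (c d e : ℂ) :
    (choiMatUnital a b c d e).PosSemidef ↔
      (c + star b / a * d, (w / a : ℝ) * d,
        (a / w : ℝ) * (e - 2 * (star b / a) * c - (star b / a) ^ 2 * d)) ∈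
        tracelessBall (w ^ 2) := by
  have ha' : (a : ℂ) ≠ 0 := by exact_mod_cast ha.ne'
  have hw' : (w : ℂ) ≠ 0 := by exact_mod_cast hw.ne'
  have hb' : b * star b + (w : ℂ) ^ 2 = a * (1 - a) := by
    rw [Complex.star_def, Complex.mul_conj']
    exact_mod_cast hb
  set A : Matrix (Fin 2) (Fin 2) ℂ := !![(a : ℂ), b; star b, 1 - (a : ℂ)] with hA
  set B : Matrix (Fin 2) (Fin 2) ℂ := !![c, d; e, -c] with hB
  set A' : Matrix (Fin 2) (Fin 2) ℂ := !![1 - (a : ℂ), -b; -star b, (a : ℂ)] with hA'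
  set L : Matrix (Fin 2) (Fin 2) ℂ := !![(a : ℂ), 0; star b, (w : ℂ)] with hL
  have hLA : L * Lᴴ = (a : ℂ) • A := by
    ext i j
    fin_cases i <;> fin_cases j <;> simp [hL, hA, mul_apply, Fin.sum_univ_two]
    · ring
    · simp at hb'
      linear_combination hb'
  have hLu : IsUnit L := by
    rw [isUnit_iff_isUnit_det, det_fin_two_of]
    simpa using ⟨ha.ne', hw.ne'⟩
  have hAL : A = ((a⁻¹ : ℝ) : ℂ) • (L * Lᴴ) := by
    rw [hLA, smul_smul]
    push_cast
    rw [inv_mul_cancel₀ ha', one_smul]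
  have hApos : A.PosDef := by
    rw [hAL]
    refine PosDef.smul ?_ (by simpa using ha)
    have := (IsUnit.posDef_star_right_conjugate_iff (x := 1) hLu).2 PosDef.one
    simpa [star_eq_conjTranspose] using this
  have hAinv : Lᴴ * A⁻¹ * L = (a : ℂ) • 1 := by
    have hLd := (isUnit_iff_isUnit_det L).1 hLu
    have hLd' : IsUnit (Lᴴ).det := by rw [det_conjTranspose]; exact hLd.star
    have : A⁻¹ = (a : ℂ) • ((Lᴴ)⁻¹ * L⁻¹) := by
      refine inv_eq_left_inv ?_
      rw [hAL]
      push_cast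
      rw [smul_mul_assoc, mul_smul_comm, smul_smul, mul_inv_cancel₀ ha', one_smul,
        Matrix.mul_assoc, nonsing_inv_mul_cancel_left _ _ hLd, nonsing_inv_mul _ hLd']
    rw [this, mul_smul_comm, smul_mul_assoc, mul_nonsing_inv_cancel_left _ _ hLd',
      nonsing_inv_mul _ hLd]
  set X : Matrix (Fin 2) (Fin 2) ℂ := !![c + star b / a * d, (w / a : ℝ) * d;
    (a / w : ℝ) * (e - 2 * (star b / a) * c - (star b / a) ^ 2 * d), -(c + star b / a * d)] with hX
  have hLX : B * L = L * X := by
    ext i j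
    fin_cases i <;> fin_cases j <;> simp [hL, hB, hX, mul_apply, Fin.sum_univ_two] <;>
      field_simp <;> ring
  have hA'L : Lᴴ * A' * L = ((a : ℂ) * (w : ℂ) ^ 2) • 1 := by
    simp at hb'
    ext i j
    fin_cases i <;> fin_cases j <;> simp [hL, hA', mul_apply, Fin.sum_univ_two]
    · linear_combination (-a : ℂ) * hb'
    all_goals ring_nf
    all_goals simp
  have hS : star L * (A' - Bᴴ * A⁻¹ * B) * L =
      (a : ℂ) • (((w ^ 2 : ℝ) : ℂ) • (1 : Matrix (Fin 2) (Fin 2) ℂ) - Xᴴ * X) := by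
    have h1 : Lᴴ * (Bᴴ * A⁻¹ * B) * L = (a : ℂ) • (Xᴴ * X) := by
      calc Lᴴ * (Bᴴ * A⁻¹ * B) * L = (B * L)ᴴ * A⁻¹ * (B * L) := by
            rw [conjTranspose_mul]; simp only [Matrix.mul_assoc]
        _ = Xᴴ * (Lᴴ * A⁻¹ * L) * X := by
            rw [hLX, conjTranspose_mul]; simp only [Matrix.mul_assoc]
        _ = _ := by rw [hAinv]; simp
    rw [star_eq_conjTranspose, Matrix.mul_sub, Matrix.sub_mul, h1, hA'L, smul_sub, smul_smul]
    push_cast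
    rfl
  have hQ : (choiMatUnital a b c d e).submatrix finSumFinEquiv finSumFinEquiv =
      fromBlocks A B Bᴴ A' := by
    ext i j
    rcases i with i | i <;> rcases j with j | j <;> fin_cases i <;> fin_cases j <;>
      simp [choiMatUnital, hA, hB, hA', finSumFinEquiv]
  have : Invertible A := hApos.isUnit.invertible
  rw [← posSemidef_submatrix_equiv (finSumFinEquiv (m := 2) (n := 2)), hQ, hApos.fromBlocks₁₁,
    ← IsUnit.posSemidef_star_left_conjugate_iff hLu, hS, ← posSemidef_sub_gram_iff]
  have hsm : ∀ {M : Matrix (Fin 2) (Fin 2) ℂ}, ((a : ℂ) • M).PosSemidef ↔ M.PosSemidef := by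
    intro M
    refine ⟨fun h => ?_, fun h => h.smul (by exact_mod_cast ha.le)⟩
    have := h.smul (α := ℂ) (a := ((a⁻¹ : ℝ) : ℂ)) (by exact_mod_cast (inv_pos.2 ha).le)
    rw [smul_smul] at this
    push_cast at this
    rwa [inv_mul_cancel₀ ha', one_smul] at this
  rw [hsm]

lemma lintegral_comp_mul_add {w : ℂ} (hw : w ≠ 0) (s : ℂ) (f : ℂ → ENNReal) :
    ∫⁻ z, f (w * z + s) = ENNReal.ofReal ((‖w‖ ^ 2)⁻¹) * ∫⁻ z, f z := by
  have hdet : LinearMap.det (LinearMap.mulLeft ℝ w) = ‖w‖ ^ 2 := by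
    rw [← Complex.normSq_eq_norm_sq, ← Algebra.norm_complex_apply, Algebra.norm_apply]
    rfl
  have hdet0 : LinearMap.det (LinearMap.mulLeft ℝ w) ≠ 0 := by
    rw [hdet]; positivity
  have hmap := Measure.map_linearMap_addHaar_eq_smul_addHaar (volume : Measure ℂ) hdet0
  have hemb : MeasurableEmbedding (LinearMap.mulLeft ℝ w) :=
    (Homeomorph.mulLeft₀ w hw).measurableEmbedding
  calc ∫⁻ z, f (w * z + s) = ∫⁻ z, f (z + s) ∂(volume.map (LinearMap.mulLeft ℝ w)) := by
        rw [hemb.lintegral_map]; rfl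
    _ = _ := by
        rw [hmap, lintegral_smul_measure, lintegral_add_right_eq_self, hdet, smul_eq_mul,
          abs_of_nonneg (by positivity)]

lemma lintegral_comp_star (f : ℂ → ENNReal) : ∫⁻ z : ℂ, f (star z) = ∫⁻ z, f z :=
  (Complex.conjLIE.measurePreserving).lintegral_comp_emb
    Complex.conjLIE.toHomeomorph.measurableEmbedding f

lemma lintegral_comp_triangular {k : ℝ} (hk : k ≠ 0) (m : ℂ) {f : ℂ × ℂ × ℂ → ENNReal}
    (hf : Measurable f) :
    ∫⁻ x : ℂ × ℂ × ℂ, f (x.1 + m * x.2.1, k * x.2.1,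
      (k⁻¹ : ℝ) * (x.2.2 - 2 * m * x.1 - m ^ 2 * x.2.1)) = ∫⁻ x, f x := by
  have hkc : (k : ℂ) ≠ 0 := by exact_mod_cast hk
  have hk' : ((k⁻¹ : ℝ) : ℂ) ≠ 0 := by exact_mod_cast inv_ne_zero hk
  set g : ℂ × ℂ → ENNReal := fun y => ∫⁻ e, f (y.1, y.2, e) with hg
  have hgm : Measurable g :=
    Measurable.lintegral_prod_right' (f := fun p : (ℂ × ℂ) × ℂ => f (p.1.1, p.1.2, p.2))
      (by fun_prop)
  have hinner : ∀ c d : ℂ, ∫⁻ e, f (c + m * d, k * d,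
      (k⁻¹ : ℝ) * (e - 2 * m * c - m ^ 2 * d)) =
        ENNReal.ofReal (k ^ 2) * g (c + m * d, k * d) := by
    intro c d
    have := lintegral_comp_mul_add hk' ((k⁻¹ : ℝ) * (- 2 * m * c - m ^ 2 * d))
      (fun e => f (c + m * d, k * d, e))
    simp only [hg]
    rw [show ENNReal.ofReal (k ^ 2) = ENNReal.ofReal ((‖((k⁻¹ : ℝ) : ℂ)‖ ^ 2)⁻¹) by
      congr 1
      rw [Complex.norm_real, Real.norm_eq_abs, sq_abs, inv_pow, inv_inv], ← this]
    congr 1 with e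
    congr 3
    ring
  have htot : ∀ F : ℂ × ℂ × ℂ → ENNReal, Measurable F →
      ∫⁻ x, F x = ∫⁻ c, ∫⁻ d, ∫⁻ e, F (c, d, e) := by
    intro F hF
    rw [Measure.volume_eq_prod, lintegral_prod _ hF.aemeasurable]
    congr 1 with c
    rw [Measure.volume_eq_prod, lintegral_prod _ (by fun_prop)]
  rw [htot _ (by fun_prop), htot f hf]
  simp only [hinner]
  calc ∫⁻ c, ∫⁻ d, ENNReal.ofReal (k ^ 2) * g (c + m * d, k * d)
      = ∫⁻ d, ∫⁻ c, ENNReal.ofReal (k ^ 2) * g (c + m * d, k * d) :=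
        lintegral_lintegral_swap (by fun_prop)
    _ = ∫⁻ d, ENNReal.ofReal (k ^ 2) * ∫⁻ c, g (c, k * d + 0) := by
        congr 1 with d
        rw [lintegral_const_mul _ (by fun_prop),
          lintegral_add_right_eq_self (fun c => g (c, k * d)) (m * d), add_zero]
    _ = ENNReal.ofReal (k ^ 2) * ∫⁻ d, ∫⁻ c, g (c, k * d + 0) :=
        lintegral_const_mul _
          (Measurable.lintegral_prod_right' (f := fun p : ℂ × ℂ => g (p.2, k * p.1 + 0))
            (by fun_prop))
    _ = ENNReal.ofReal (k ^ 2) * (ENNReal.ofReal ((k ^ 2)⁻¹) * ∫⁻ d, ∫⁻ c, g (c, d)) := by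
        rw [lintegral_comp_mul_add hkc 0 (fun d => ∫⁻ c, g (c, d)), Complex.norm_real,
          Real.norm_eq_abs, sq_abs]
    _ = ∫⁻ d, ∫⁻ c, g (c, d) := by
        rw [← mul_assoc, ← ENNReal.ofReal_mul (by positivity), mul_inv_cancel₀ (by positivity),
          ENNReal.ofReal_one, one_mul]
    _ = _ := lintegral_lintegral_swap (by fun_prop)

lemma lintegral_traceless_coords {f : ℂ × ℂ × ℂ → ENNReal} (hf : Measurable f) :
    ∫⁻ x, f x = 4 * ∫⁻ v : ℝ × ℂ, ∫⁻ u : ℝ × ℂ,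
      f (u.1 + v.1 * Complex.I, u.2 + Complex.I * v.2, star (u.2 - Complex.I * v.2)) := by
  have hinner : ∀ c : ℂ, ∫⁻ y : ℂ × ℂ, f (c, y) =
      4 * ∫⁻ V : ℂ, ∫⁻ U : ℂ, f (c, U + Complex.I * V, star (U - Complex.I * V)) := by
    intro c
    calc ∫⁻ y : ℂ × ℂ, f (c, y) = ∫⁻ d, ∫⁻ e, f (c, d, star e) := by
          rw [Measure.volume_eq_prod, lintegral_prod _ (by fun_prop)]
          congr 1 with d
          rw [lintegral_comp_star (fun e => f (c, d, e))]
      _ = ∫⁻ d, ∫⁻ V, 4 * f (c, d, star (-2 * Complex.I * V + d)) := by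
          congr 1 with d
          have hI : -2 * Complex.I ≠ 0 := by simp
          rw [lintegral_const_mul _ (by fun_prop),
            lintegral_comp_mul_add hI d (fun e => f (c, d, star e)), ← mul_assoc]
          have : (4 : ENNReal) = ENNReal.ofReal 4 := by simp
          rw [this, ← ENNReal.ofReal_mul (by norm_num)]
          norm_num
      _ = ∫⁻ V, ∫⁻ d, 4 * f (c, d, star (-2 * Complex.I * V + d)) :=
          lintegral_lintegral_swap (by fun_prop)
      _ = ∫⁻ V, ∫⁻ U, 4 * f (c, U + Complex.I * V, star (U - Complex.I * V)) := by
          congr 1 with V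
          rw [← lintegral_add_right_eq_self _ (Complex.I * V)]
          congr 1 with U
          congr 5
          ring
      _ = ∫⁻ V, 4 * ∫⁻ U, f (c, U + Complex.I * V, star (U - Complex.I * V)) := by
          congr 1 with V
          rw [lintegral_const_mul _ (by fun_prop)]
      _ = _ := lintegral_const_mul _
          (Measurable.lintegral_prod_right' (f := fun p : ℂ × ℂ =>
            f (c, p.2 + Complex.I * p.1, star (p.2 - Complex.I * p.1))) (by fun_prop))
  set G : ℝ × ℂ → ℝ × ℂ → ENNReal := fun u v =>
    f (u.1 + v.1 * Complex.I, u.2 + Complex.I * v.2, star (u.2 - Complex.I * v.2)) with hG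
  set h : ℂ → ENNReal := fun c =>
    ∫⁻ V : ℂ, ∫⁻ U : ℂ, f (c, U + Complex.I * V, star (U - Complex.I * V)) with hh
  have hhm : Measurable h := by
    refine Measurable.lintegral_prod_right' (f := fun p : ℂ × ℂ =>
      ∫⁻ U : ℂ, f (p.1, U + Complex.I * p.2, star (U - Complex.I * p.2))) ?_
    exact Measurable.lintegral_prod_right' (f := fun p : (ℂ × ℂ) × ℂ =>
      f (p.1.1, p.2 + Complex.I * p.1.2, star (p.2 - Complex.I * p.1.2))) (by fun_prop)
  have h1 : ∫⁻ x, f x = 4 * ∫⁻ c, h c := by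
    rw [Measure.volume_eq_prod, lintegral_prod _ hf.aemeasurable, ← lintegral_const_mul _ hhm]
    exact lintegral_congr hinner
  have h2 : ∫⁻ c, h c = ∫⁻ s : ℝ, ∫⁻ y : ℝ, h (s + y * Complex.I) := by
    rw [← Complex.volume_preserving_equiv_real_prod.symm.lintegral_comp hhm,
      Measure.volume_eq_prod, lintegral_prod _ (by fun_prop)]
    simp [Complex.mk_eq_add_mul_I]
  have h3 : ∀ s : ℝ, ∫⁻ y : ℝ, h (s + y * Complex.I) = ∫⁻ v : ℝ × ℂ, ∫⁻ U : ℂ, G (s, U) v := by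
    intro s
    rw [Measure.volume_eq_prod, lintegral_prod]
    exact (Measurable.lintegral_prod_right' (f := fun p : (ℝ × ℂ) × ℂ => G (s, p.2) p.1)
      (by fun_prop)).aemeasurable
  rw [h1, h2]
  simp only [h3]
  rw [lintegral_lintegral_swap]
  · congr 1
    refine lintegral_congr fun v => ?_
    rw [Measure.volume_eq_prod ℝ ℂ, lintegral_prod _ (by fun_prop)]
  · exact (Measurable.lintegral_prod_right' (f := fun p : (ℝ × ℝ × ℂ) × ℂ =>
      G (p.1.1, p.2) p.1.2) (by fun_prop)).aemeasurable

lemma lintegral_complex_radial {g : ℝ → ℝ} (hg : Continuous g) {R : ℝ} (hR : 0 ≤ R)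
    (hpos : ∀ y ∈ Set.Icc 0 R, 0 ≤ g y) (hzero : ∀ y, R < y → g y ≤ 0) :
    ∫⁻ z : ℂ, ENNReal.ofReal (g ‖z‖) = ENNReal.ofReal (2 * π * ∫ y in (0 : ℝ)..R, y * g y) := by
  set f : ℝ → ℝ := (Set.Iic R).indicator g with hf
  have hfg : ∀ z : ℂ, ENNReal.ofReal (g ‖z‖) = ENNReal.ofReal (f ‖z‖) := by
    intro z
    by_cases hz : ‖z‖ ≤ R
    · simp [hf, hz]
    · simp [hf, hz, ENNReal.ofReal_of_nonpos (hzero _ (not_le.1 hz))]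
  have hmul : (fun y : ℝ => y ^ (Module.finrank ℝ ℂ - 1) • f y) =
      (Set.Iic R).indicator (fun y => y * g y) := by
    ext y
    by_cases hy : y ≤ R <;> simp [hf, hy, Complex.finrank_real_complex]
  have hset : Set.Ioi 0 ∩ Set.Iic R = Set.Ioc 0 R := Set.Ioi_inter_Iic
  have hint : Integrable (fun z : ℂ => f ‖z‖) := by
    rw [integrable_fun_norm_addHaar volume (f := f), hmul, IntegrableOn,
      integrable_indicator_iff measurableSet_Iic, IntegrableOn,
      Measure.restrict_restrict measurableSet_Iic, Set.inter_comm, hset]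
    exact ((Continuous.continuousOn (by fun_prop)).integrableOn_compact
      (isCompact_Icc (a := 0) (b := R))).mono_set Set.Ioc_subset_Icc_self
  have hf0 : ∀ z : ℂ, 0 ≤ f ‖z‖ := by
    intro z
    by_cases hz : ‖z‖ ≤ R
    · simpa [hf, hz] using hpos _ ⟨norm_nonneg z, hz⟩
    · simp [hf, hz]
  simp only [hfg]
  rw [← ofReal_integral_eq_lintegral_ofReal hint (.of_forall hf0),
    integral_fun_norm_addHaar volume f, hmul, setIntegral_indicator measurableSet_Iic, hset,
    intervalIntegral.integral_of_le hR, Complex.finrank_real_complex]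
  congr 1
  simp [Measure.real, mul_assoc]

lemma lintegral_cone_pow_three {R : ℝ} (hR : 0 ≤ R) :
    ∫⁻ z : ℂ, ENNReal.ofReal ((R - ‖z‖) ^ 3) = ENNReal.ofReal (π / 10 * R ^ 5) := by
  rw [lintegral_complex_radial (g := fun y => (R - y) ^ 3) (by fun_prop) hR]
  · have : ∫ y in (0 : ℝ)..R, y * (R - y) ^ 3 = R ^ 5 / 20 := by
      rw [intervalIntegral.integral_eq_sub_of_hasDerivAt
        (f := fun y => - (R * (R - y) ^ 4) / 4 + (R - y) ^ 5 / 5)]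
      · ring
      · intro y _
        have h := (hasDerivAt_id y).const_sub R
        convert! (((h.pow 4).const_mul R).neg.div_const 4).add ((h.pow 5).div_const 5) using 1
        simp
        ring
      · exact Continuous.intervalIntegrable (by fun_prop) _ _
    rw [this]
    congr 1
    ring
  · exact fun y hy => pow_nonneg (sub_nonneg.2 hy.2) 3
  · exact fun y hy => Odd.pow_nonpos (by decide) (by linarith)

lemma lintegral_paraboloid_pow_three {t : ℝ} (ht : 0 ≤ t) :
    ∫⁻ z : ℂ, ENNReal.ofReal ((t - ‖z‖ ^ 2) ^ 3) = ENNReal.ofReal (π / 4 * t ^ 4) := by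
  rw [lintegral_complex_radial (g := fun y => (t - y ^ 2) ^ 3) (by fun_prop) (Real.sqrt_nonneg t)]
  · have : ∫ y in (0 : ℝ)..√t, y * (t - y ^ 2) ^ 3 = t ^ 4 / 8 := by
      rw [intervalIntegral.integral_eq_sub_of_hasDerivAt
        (f := fun y => - (t - y ^ 2) ^ 4 / 8)]
      · rw [Real.sq_sqrt ht]
        ring
      · intro y _
        have h := ((hasDerivAt_id y).pow 2).const_sub t
        convert! (h.pow 4).neg.div_const 8 using 1
        simp
        ring
      · exact Continuous.intervalIntegrable (by fun_prop) _ _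
    rw [this]
    congr 1
    ring
  · intro y hy
    have := Real.sq_sqrt ht
    exact pow_nonneg (by nlinarith [hy.1, hy.2]) 3
  · intro y hy
    have := Real.sq_sqrt ht
    exact Odd.pow_nonpos (by decide) (by nlinarith [Real.sqrt_nonneg t])

lemma lintegral_sqrt_sub_sq_pow_five {D : ℝ} (hD : 0 ≤ D) :
    ∫⁻ y : ℝ, ENNReal.ofReal (√(D - y ^ 2) ^ 5) = ENNReal.ofReal (5 * π / 16 * D ^ 3) := by
  have hsq := Real.sq_sqrt hD
  have hs := Real.sqrt_nonneg D
  have hzero : ∀ y ∉ Set.Ioc (-√D) √D, √(D - y ^ 2) ^ 5 = 0 := by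
    intro y hy
    rw [Real.sqrt_eq_zero_of_nonpos, zero_pow (by norm_num)]
    by_contra! h
    refine hy ⟨?_, ?_⟩ <;> nlinarith
  have hcont : Continuous fun y : ℝ => √(D - y ^ 2) ^ 5 := by fun_prop
  have hint : Integrable fun y : ℝ => √(D - y ^ 2) ^ 5 := by
    rw [← integrableOn_iff_integrable_of_support_subset (s := Set.Icc (-√D) √D)]
    · exact hcont.continuousOn.integrableOn_compact isCompact_Icc
    · intro y hy
      by_contra h
      exact hy (hzero y fun h' => h (Set.Ioc_subset_Icc_self h'))
  rw [← ofReal_integral_eq_lintegral_ofReal hint (.of_forall fun y => by positivity),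
    ← setIntegral_eq_integral_of_forall_compl_eq_zero hzero,
    ← intervalIntegral.integral_of_le (by linarith)]
  congr 1
  have hsub := intervalIntegral.integral_comp_mul_deriv (a := -(π / 2)) (b := π / 2)
    (f := fun θ => √D * sin θ) (f' := fun θ => √D * cos θ) (g := fun y : ℝ => √(D - y ^ 2) ^ 5)
    (fun θ _ => (Real.hasDerivAt_sin θ).const_mul _) (by fun_prop) hcont
  simp only [Real.sin_neg, Real.sin_pi_div_two, mul_one, mul_neg] at hsub
  rw [← hsub]
  have hcos : ∫ θ in (-(π / 2))..(π / 2), cos θ ^ 6 = 5 * π / 16 := by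
    rw [integral_cos_pow, integral_cos_pow, integral_cos_sq]
    simp
    ring
  rw [← hcos, mul_comm, ← intervalIntegral.integral_const_mul]
  refine intervalIntegral.integral_congr fun θ hθ => ?_
  rw [Set.uIcc_of_le (by linarith [pi_pos])] at hθ
  have hc := Real.cos_nonneg_of_mem_Icc hθ
  have : √(D - (√D * sin θ) ^ 2) = √D * cos θ := by
    rw [show D - (√D * sin θ) ^ 2 = (√D * cos θ) ^ 2 by
      rw [mul_pow, mul_pow, hsq, Real.cos_sq']; ring]
    exact Real.sqrt_sq (mul_nonneg hs hc)
  simp only [Function.comp, this]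
  calc (√D * cos θ) ^ 5 * (√D * cos θ) = (√D ^ 2) ^ 3 * cos θ ^ 6 := by ring
    _ = _ := by rw [hsq]

/-- The pairs `(u, v)` of vectors for which the traceless matrix with coordinates `u + i v` in the
Pauli basis has operator norm at most `√D`. -/
def pairBall {E : Type*} [NormedAddCommGroup E] [InnerProductSpace ℝ E] (D : ℝ) (u v : E) : Prop :=
  ‖u‖ ^ 2 + ‖v‖ ^ 2 ≤ D ∧ 0 ≤ D ^ 2 - 2 * D * (‖u‖ ^ 2 + ‖v‖ ^ 2) +
    ((‖u‖ ^ 2 - ‖v‖ ^ 2) ^ 2 + 4 * inner ℝ u v ^ 2)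

lemma mem_tracelessBall_iff_pairBall (D : ℝ) (u v : ℝ × ℂ) :
    ((u.1 + v.1 * Complex.I, u.2 + Complex.I * v.2, star (u.2 - Complex.I * v.2)) :
      ℂ × ℂ × ℂ) ∈ tracelessBall D ↔ pairBall D (WithLp.toLp 2 u) (WithLp.toLp 2 v) := by
  obtain ⟨s, U⟩ := u
  obtain ⟨y, V⟩ := v
  simp only [tracelessBall, pairBall, Set.mem_ofPred_eq, WithLp.prod_norm_sq_eq_of_L2,
    WithLp.prod_inner_apply, ← Complex.normSq_eq_norm_sq, Complex.normSq_apply]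
  simp [Complex.inner, pow_two]
  ring_nf

lemma volume_pairBall_rotate {E : Type*} [NormedAddCommGroup E] [InnerProductSpace ℝ E]
    [FiniteDimensional ℝ E] [MeasurableSpace E] [BorelSpace E] (D : ℝ) {u u' : E}
    (h : ‖u‖ = ‖u'‖) : volume {v | pairBall D u v} = volume {v | pairBall D u' v} := by
  set ρ := (ℝ ∙ (u - u'))ᗮ.reflection
  have hρ : ρ u = u' := Submodule.reflection_sub h
  have hpre : {v | pairBall D u v} = ρ ⁻¹' {v | pairBall D u' v} := by
    ext v
    simp only [pairBall, Set.mem_ofPred_eq, Set.mem_preimage, ← hρ, LinearIsometryEquiv.norm_map,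
      LinearIsometryEquiv.inner_map_map]
  rw [hpre]
  exact ρ.measurePreserving.measure_preimage_emb ρ.toHomeomorph.measurableEmbedding _

lemma pairBall_axis_iff (D s : ℝ) (hs : 0 ≤ s) (y : ℝ) (V : ℂ) :
    pairBall D (WithLp.toLp 2 ((s, 0) : ℝ × ℂ)) (WithLp.toLp 2 (y, V)) ↔
      y ^ 2 + (s + ‖V‖) ^ 2 ≤ D := by
  have hV := norm_nonneg V
  simp only [pairBall, WithLp.prod_norm_sq_eq_of_L2, WithLp.prod_inner_apply]
  simp
  constructor
  · rintro ⟨h1, h2⟩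
    have h3 : (2 * s * ‖V‖) ^ 2 ≤ (D - (s ^ 2 + y ^ 2 + ‖V‖ ^ 2)) ^ 2 := by nlinarith
    have := abs_le_of_sq_le_sq h3 (by linarith)
    nlinarith [(abs_le.1 this).2]
  · intro h
    have h0 : 0 ≤ s * ‖V‖ := by positivity
    have h1 : 0 ≤ D - (s ^ 2 + y ^ 2 + ‖V‖ ^ 2) - 2 * s * ‖V‖ := by nlinarith
    refine ⟨by nlinarith, ?_⟩
    have h2 : 0 ≤ (D - (s ^ 2 + y ^ 2 + ‖V‖ ^ 2) - 2 * s * ‖V‖) *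
      (D - (s ^ 2 + y ^ 2 + ‖V‖ ^ 2) + 2 * s * ‖V‖) := mul_nonneg h1 (by nlinarith)
    nlinarith

lemma measurableSet_tracelessBall (D : ℝ) : MeasurableSet (tracelessBall D) := by
  rw [tracelessBall, Set.ofPred_and]
  exact (measurableSet_le (by fun_prop) (by fun_prop)).inter
    (measurableSet_le (by fun_prop) (by fun_prop))

lemma volume_fiber (D y : ℝ) (V : ℂ) :
    volume {u : WithLp 2 (ℝ × ℂ) | y ^ 2 + (‖u‖ + ‖V‖) ^ 2 ≤ D} =
      ENNReal.ofReal (4 * π / 3) * ENNReal.ofReal ((√(D - y ^ 2) - ‖V‖) ^ 3) := by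
  have hV := norm_nonneg V
  have hdim : Module.finrank ℝ (WithLp 2 (ℝ × ℂ)) = 2 * 1 + 1 := by
    rw [(WithLp.linearEquiv 2 ℝ (ℝ × ℂ)).finrank_eq]
    simp [Complex.finrank_real_complex]
  rcases lt_or_ge D (y ^ 2) with hD | hD
  · have : {u : WithLp 2 (ℝ × ℂ) | y ^ 2 + (‖u‖ + ‖V‖) ^ 2 ≤ D} = ∅ := by
      ext u
      simp only [Set.mem_ofPred_eq, Set.mem_empty_iff_false, iff_false, not_le]
      nlinarith [sq_nonneg (‖u‖ + ‖V‖)]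
    rw [this, measure_empty, Real.sqrt_eq_zero_of_nonpos (by linarith),
      ENNReal.ofReal_of_nonpos (p := (0 - ‖V‖) ^ 3)
        (Odd.pow_nonpos (by decide) (by linarith)), mul_zero]
  · have : {u : WithLp 2 (ℝ × ℂ) | y ^ 2 + (‖u‖ + ‖V‖) ^ 2 ≤ D} =
        Metric.closedBall 0 (√(D - y ^ 2) - ‖V‖) := by
      ext u
      have hu := norm_nonneg u
      rw [mem_closedBall_zero_iff, le_sub_iff_add_le, Real.le_sqrt (add_nonneg hu hV) (sub_nonneg.2 hD)]
      simp only [Set.mem_ofPred_eq]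
      constructor <;> intro h <;> linarith
    rw [this, InnerProductSpace.volume_closedBall_of_dim_odd hdim, hdim, mul_comm]
    congr 1
    · norm_num [Nat.doubleFactorial]
      congr 1
      ring
    · rcases le_or_gt 0 (√(D - y ^ 2) - ‖V‖) with h | h
      · rw [← ENNReal.ofReal_pow h]
      · rw [ENNReal.ofReal_of_nonpos h.le, ENNReal.ofReal_of_nonpos
          (Odd.pow_nonpos (by decide) h.le)]
        simp

lemma measurableSet_pairBall (D : ℝ) :
    MeasurableSet {p : WithLp 2 (ℝ × ℂ) × WithLp 2 (ℝ × ℂ) | pairBall D p.1 p.2} := by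
  simp only [pairBall]
  rw [Set.ofPred_and]
  exact (measurableSet_le (by fun_prop) (by fun_prop)).inter
    (measurableSet_le (by fun_prop) (by fun_prop))

lemma volume_join_ball {D : ℝ} (hD : 0 ≤ D) :
    volume {p : WithLp 2 (ℝ × ℂ) × ℝ × ℂ | p.2.1 ^ 2 + (‖p.1‖ + ‖p.2.2‖) ^ 2 ≤ D} =
      ENNReal.ofReal (π ^ 3 / 24 * D ^ 3) := by
  have hmeasS : MeasurableSet
      {p : WithLp 2 (ℝ × ℂ) × ℝ × ℂ | p.2.1 ^ 2 + (‖p.1‖ + ‖p.2.2‖) ^ 2 ≤ D} :=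
    measurableSet_le (by fun_prop) (by fun_prop)
  rw [Measure.volume_eq_prod, Measure.prod_apply_symm hmeasS, Measure.volume_eq_prod,
    lintegral_prod _ (measurable_measure_prodMk_right hmeasS).aemeasurable]
  calc ∫⁻ y : ℝ, ∫⁻ V : ℂ, volume {u : WithLp 2 (ℝ × ℂ) | y ^ 2 + (‖u‖ + ‖V‖) ^ 2 ≤ D}
      = ∫⁻ y : ℝ, ENNReal.ofReal (4 * π / 3) *
          (ENNReal.ofReal (π / 10) * ENNReal.ofReal (√(D - y ^ 2) ^ 5)) := by
        refine lintegral_congr fun y => ?_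
        simp only [volume_fiber]
        rw [lintegral_const_mul _ (by fun_prop), lintegral_cone_pow_three (Real.sqrt_nonneg _),
          ENNReal.ofReal_mul (by positivity)]
    _ = _ := by
        rw [lintegral_const_mul _ (by fun_prop), lintegral_const_mul _ (by fun_prop),
          lintegral_sqrt_sub_sq_pow_five hD, ← ENNReal.ofReal_mul (by positivity),
          ← ENNReal.ofReal_mul (by positivity)]
        congr 1
        ring

lemma volume_pairBall {D : ℝ} (hD : 0 ≤ D) :
    volume {p : WithLp 2 (ℝ × ℂ) × WithLp 2 (ℝ × ℂ) | pairBall D p.1 p.2} =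
      ENNReal.ofReal (π ^ 3 / 24 * D ^ 3) := by
  have hmeasS : MeasurableSet
      {p : WithLp 2 (ℝ × ℂ) × ℝ × ℂ | p.2.1 ^ 2 + (‖p.1‖ + ‖p.2.2‖) ^ 2 ≤ D} :=
    measurableSet_le (by fun_prop) (by fun_prop)
  rw [← volume_join_ball hD, Measure.volume_eq_prod, Measure.prod_apply (measurableSet_pairBall D),
    Measure.volume_eq_prod, Measure.prod_apply hmeasS]
  refine lintegral_congr fun u => ?_
  have h1 : ‖u‖ = ‖WithLp.toLp 2 ((‖u‖, 0) : ℝ × ℂ)‖ := by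
    simp [WithLp.prod_norm_eq_of_L2 (WithLp.toLp 2 ((‖u‖, 0) : ℝ × ℂ))]
  calc volume {v | pairBall D u v} = _ := volume_pairBall_rotate D h1
    _ = _ := by
      rw [← (WithLp.volume_preserving_toLp ℝ ℂ).measure_preimage_emb
        (MeasurableEquiv.toLp 2 (ℝ × ℂ)).measurableEmbedding]
      congr 1
      ext v
      exact pairBall_axis_iff D ‖u‖ (norm_nonneg u) v.1 v.2

lemma volume_pairBall_toLp (D : ℝ) :
    ∫⁻ v : ℝ × ℂ, volume {u : ℝ × ℂ | pairBall D (WithLp.toLp 2 u) (WithLp.toLp 2 v)} =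
      volume {p : WithLp 2 (ℝ × ℂ) × WithLp 2 (ℝ × ℂ) | pairBall D p.1 p.2} := by
  have hmp := WithLp.volume_preserving_toLp ℝ ℂ
  have hemb := (MeasurableEquiv.toLp 2 (ℝ × ℂ)).measurableEmbedding
  rw [Measure.volume_eq_prod (WithLp 2 (ℝ × ℂ)), Measure.prod_apply_symm (measurableSet_pairBall D),
    ← hmp.lintegral_comp_emb hemb]
  refine lintegral_congr fun v => ?_
  rw [← hmp.measure_preimage_emb hemb]
  rfl

lemma volume_tracelessBall {D : ℝ} (hD : 0 ≤ D) :
    volume (tracelessBall D) = ENNReal.ofReal (π ^ 3 / 6 * D ^ 3) := by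
  rw [← lintegral_indicator_one (measurableSet_tracelessBall D),
    lintegral_traceless_coords (measurable_one.indicator (measurableSet_tracelessBall D))]
  have hpair : ∀ v : ℝ × ℂ, ∫⁻ u : ℝ × ℂ, (tracelessBall D).indicator (1 : ℂ × ℂ × ℂ → ENNReal)
      ((u.1 + v.1 * Complex.I, u.2 + Complex.I * v.2, star (u.2 - Complex.I * v.2)) :
        ℂ × ℂ × ℂ) =
      volume {u : ℝ × ℂ | pairBall D (WithLp.toLp 2 u) (WithLp.toLp 2 v)} := by
    intro v
    have hpre : MeasurableSet {u : ℝ × ℂ | pairBall D (WithLp.toLp 2 u) (WithLp.toLp 2 v)} :=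
      (measurableSet_pairBall D).preimage
        (f := fun u : ℝ × ℂ => (WithLp.toLp 2 u, WithLp.toLp 2 v)) (by fun_prop)
    rw [← lintegral_indicator_one hpre]
    refine lintegral_congr fun u => ?_
    classical exact if_congr (mem_tracelessBall_iff_pairBall D u v) rfl rfl
  simp only [hpair]
  rw [volume_pairBall_toLp, volume_pairBall hD, show (4 : ENNReal) = ENNReal.ofReal 4 by simp,
    ← ENNReal.ofReal_mul (by norm_num)]
  congr 1
  ring

lemma isClosed_posSemidef {n : Type*} [Fintype n] :
    IsClosed {M : Matrix n n ℂ | M.PosSemidef} := by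
  simp only [posSemidef_iff_dotProduct_mulVec, IsHermitian, Set.ofPred_and, Set.ofPred_forall]
  refine (isClosed_eq (by fun_prop) continuous_id).inter (isClosed_iInter fun x => ?_)
  exact isClosed_le continuous_const (by fun_prop)

lemma measurableSet_choiMatUnital_posSemidef (a : ℝ) :
    MeasurableSet {p : ℂ × ℂ × ℂ × ℂ |
      (choiMatUnital a p.1 p.2.1 p.2.2.1 p.2.2.2).PosSemidef} := by
  refine (isClosed_posSemidef.preimage (f := fun p : ℂ × ℂ × ℂ × ℂ =>
    choiMatUnital a p.1 p.2.1 p.2.2.1 p.2.2.2) ?_).measurableSet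
  refine continuous_matrix fun i j => ?_
  fin_cases i <;> fin_cases j <;> simp [choiMatUnital] <;> fun_prop

lemma volume_choiMatUnital_section {a : ℝ} (ha : 0 < a) {b : ℂ} (hb : ‖b‖ ^ 2 < a * (1 - a)) :
    volume {x : ℂ × ℂ × ℂ | (choiMatUnital a b x.1 x.2.1 x.2.2).PosSemidef} =
      ENNReal.ofReal (π ^ 3 / 6 * (a * (1 - a) - ‖b‖ ^ 2) ^ 3) := by
  set D := a * (1 - a) - ‖b‖ ^ 2 with hD
  have hD0 : 0 < D := sub_pos.2 hb
  have hw : 0 < √D := Real.sqrt_pos.2 hD0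
  have hw2 : √D ^ 2 = D := Real.sq_sqrt hD0.le
  have hiff := choiMatUnital_posSemidef_iff ha hw (b := b) (by rw [hw2]; ring)
  have hk : √D / a ≠ 0 := (div_pos hw ha).ne'
  rw [← volume_tracelessBall hD0.le, ← lintegral_indicator_one (measurableSet_tracelessBall D),
    ← lintegral_comp_triangular hk (star b / a)
      (measurable_one.indicator (measurableSet_tracelessBall D))]
  have hmeas : MeasurableSet {x : ℂ × ℂ × ℂ | (choiMatUnital a b x.1 x.2.1 x.2.2).PosSemidef} :=
    measurable_prodMk_left (measurableSet_choiMatUnital_posSemidef a)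
  rw [← lintegral_indicator_one hmeas]
  refine lintegral_congr fun x => ?_
  have hx := hiff x.1 x.2.1 x.2.2
  rw [hw2, ← inv_div √D a] at hx
  classical exact if_congr hx rfl rfl

/-- The distribution of the volume of unital qubit channels over classical channels:
for `a ∈ [0,1]`, `2⁷` times the 8-dimensional Lebesgue measure of the set of
`(b,c,d,e) ∈ ℂ⁴` making the unital Choi matrix positive semidefinite equals
`(2⁴π⁴/3)·a⁴(1−a)⁴`. -/
theorem volume_unital_over_classical (a : ℝ) (ha : a ∈ Set.Icc (0 : ℝ) 1) :
    2 ^ 7 * volume {p : ℂ × ℂ × ℂ × ℂ |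
        (choiMatUnital a p.1 p.2.1 p.2.2.1 p.2.2.2).PosSemidef}
      = ENNReal.ofReal (2 ^ 4 * π ^ 4 / 3 * (a ^ 4 * (1 - a) ^ 4)) := by
  obtain ⟨ha0, ha1⟩ := ha
  have ht : 0 ≤ a * (1 - a) := mul_nonneg ha0 (sub_nonneg.2 ha1)
  have hsphere : ∀ᵐ b : ℂ, ‖b‖ ^ 2 ≠ a * (1 - a) := by
    rw [ae_iff]
    refine measure_mono_null (fun b hb => ?_) (Measure.addHaar_sphere volume 0 √(a * (1 - a)))
    simp only [ne_eq, not_not, Set.mem_ofPred_eq] at hb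
    rw [mem_sphere_zero_iff_norm, ← hb, Real.sqrt_sq (norm_nonneg b)]
  have hsec : ∀ᵐ b : ℂ,
      volume {x : ℂ × ℂ × ℂ | (choiMatUnital a b x.1 x.2.1 x.2.2).PosSemidef} =
        ENNReal.ofReal (π ^ 3 / 6) * ENNReal.ofReal ((a * (1 - a) - ‖b‖ ^ 2) ^ 3) := by
    filter_upwards [hsphere] with b hb
    rcases lt_or_gt_of_ne hb with h | h
    · have ha' : 0 < a := ha0.lt_of_ne' fun h0 => by
        simp only [h0, zero_mul] at h
        exact absurd h (not_lt.2 (sq_nonneg _))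
      rw [volume_choiMatUnital_section ha' h, ENNReal.ofReal_mul (by positivity)]
    · have : {x : ℂ × ℂ × ℂ | (choiMatUnital a b x.1 x.2.1 x.2.2).PosSemidef} = ∅ :=
        Set.eq_empty_of_forall_notMem fun x hx => (choiMatUnital_norm_sq_le hx).not_gt h
      rw [this, measure_empty, ENNReal.ofReal_of_nonpos (p := (_ - _) ^ 3)
        (Odd.pow_nonpos (by decide) (by linarith)), mul_zero]
  rw [Measure.volume_eq_prod, Measure.prod_apply (measurableSet_choiMatUnital_posSemidef a)]
  calc 2 ^ 7 * ∫⁻ b : ℂ,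
        volume {x : ℂ × ℂ × ℂ | (choiMatUnital a b x.1 x.2.1 x.2.2).PosSemidef}
      = 2 ^ 7 * ENNReal.ofReal (π ^ 3 / 6 * (π / 4 * (a * (1 - a)) ^ 4)) := by
        rw [lintegral_congr_ae hsec, lintegral_const_mul _ (by fun_prop),
          lintegral_paraboloid_pow_three ht, ← ENNReal.ofReal_mul (by positivity)]
    _ = _ := by
        rw [show (2 : ENNReal) ^ 7 = ENNReal.ofReal (2 ^ 7) by norm_num,
          ← ENNReal.ofReal_mul (by norm_num)]
        congr 1
        ring
end

section
/- The volume of the space 𝒬¹ of unital qubit channels equals 8π⁴/945; that is, 2⁷ times the 9-dimensional Lebesgue measure of the set {(a,b,c,d,e) ∈ [0,1] × ℂ⁴ : Q¹(a,b,c,d,e) is positive semidefinite} equals 8π⁴/945. -/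
open MeasureTheory Matrix Real ComplexOrder

/-- The Hermitian matrix with the off-diagonal pattern of `choiMatUnital` and independent diagonal
entries `s`, `t`. Its `{0, 3}` block is determined by `(s, d)` and its `{1, 2}` block by `(t, e)`. -/
noncomputable def blockMat (s t : ℝ) (d e b c : ℂ) : Matrix (Fin 4) (Fin 4) ℂ :=
  !![(s : ℂ), b, c, d;
     star b, (t : ℂ), e, -c;
     star c, star e, (t : ℂ), -b;
     star d, -star c, -star b, (s : ℂ)]

theorem blockMat_isHermitian (s t : ℝ) (d e b c : ℂ) : (blockMat s t d e b c).IsHermitian := by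
  ext i j
  fin_cases i <;> fin_cases j <;> simp [blockMat]

theorem norm_le_of_blockMat_posSemidef {s t : ℝ} {d e b c : ℂ} (hs : 0 ≤ s) (ht : 0 ≤ t)
    (h : (blockMat s t d e b c).PosSemidef) : ‖d‖ ≤ s ∧ ‖e‖ ≤ t := by
  have h1 := (h.submatrix ![0, 3]).det_nonneg
  have h2 := (h.submatrix ![1, 2]).det_nonneg
  simp only [det_fin_two, blockMat, submatrix_apply] at h1 h2
  simp [Complex.mul_conj, Complex.normSq_eq_norm_sq, ← Complex.ofReal_mul, -Complex.ofReal_pow] at h1 h2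
  exact ⟨by nlinarith [norm_nonneg d], by nlinarith [norm_nonneg e]⟩

theorem exists_unit_mul_norm (b : ℂ) : ∃ u : ℂ, u * star u = 1 ∧ b * u = ‖b‖ := by
  rcases eq_or_ne b 0 with rfl | hb
  · exact ⟨1, by simp⟩
  · have hb' : (‖b‖ : ℂ) ≠ 0 := by simpa using hb
    have : b * star b = (‖b‖ : ℂ) ^ 2 := by
      simpa using Complex.mul_conj' b
    refine ⟨star b / ‖b‖, ?_, ?_⟩
    · simp at this ⊢
      field_simp
      rw [← this]; ring
    · rw [← mul_div_assoc, this]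
      field_simp

theorem blockMat_one_posSemidef_iff (b c : ℂ) :
    (blockMat 1 1 0 0 b c).PosSemidef ↔ ‖b‖ + ‖c‖ ≤ 1 := by
  have key (x : Fin 4 → ℂ) : star x ⬝ᵥ (blockMat 1 1 0 0 b c *ᵥ x) =
      ((‖x 0‖ ^ 2 + ‖x 1‖ ^ 2 + ‖x 2‖ ^ 2 + ‖x 3‖ ^ 2 +
        2 * (b * (star (x 0) * x 1)).re + 2 * (c * (star (x 0) * x 2)).re
        - 2 * (c * (star (x 1) * x 3)).re - 2 * (b * (star (x 2) * x 3)).re : ℝ) : ℂ) := by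
    simp only [Complex.sq_norm, Complex.normSq_apply]
    apply Complex.ext <;> simp [blockMat, dotProduct, mulVec, Fin.sum_univ_succ] <;> ring
  constructor
  · intro h
    obtain ⟨u, hu, hbu⟩ := exists_unit_mul_norm b
    obtain ⟨v, hv, hcv⟩ := exists_unit_mul_norm c
    have hx := h.dotProduct_mulVec_nonneg ![1, -u, -v, -(u * v)]
    have hu' : ‖u‖ = 1 := by
      have := congrArg norm hu
      simp only [norm_mul, norm_star, norm_one] at this
      nlinarith [norm_nonneg u]
    have hv' : ‖v‖ = 1 := by
      have := congrArg norm hv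
      simp only [norm_mul, norm_star, norm_one] at this
      nlinarith [norm_nonneg v]
    rw [key, Complex.zero_le_real] at hx
    have e1 : b * (star (1 : ℂ) * -u) = ((-‖b‖ : ℝ) : ℂ) := by
      push_cast; rw [← hbu]; simp
    have e2 : c * (star (1 : ℂ) * -v) = ((-‖c‖ : ℝ) : ℂ) := by
      push_cast; rw [← hcv]; simp
    have e3 : c * (star (-u) * -(u * v)) = ((‖c‖ : ℝ) : ℂ) := by
      rw [← hcv, star_neg]; linear_combination c * v * hu
    have e4 : b * (star (-v) * -(u * v)) = ((‖b‖ : ℝ) : ℂ) := by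
      rw [← hbu, star_neg]; linear_combination b * u * hv
    simp only [cons_val] at hx
    rw [e1, e2, e3, e4] at hx
    simp only [norm_neg, norm_mul, norm_one, hu', hv', Complex.ofReal_re] at hx
    linarith
  · intro h
    refine .of_dotProduct_mulVec_nonneg (blockMat_isHermitian _ _ _ _ _ _) fun x => ?_
    rw [key, Complex.zero_le_real]
    have aux (z p q : ℂ) : |(z * (star p * q)).re| ≤ ‖z‖ * (‖p‖ * ‖q‖) := by
      refine (Complex.abs_re_le_norm _).trans ?_
      simp
    have h1 := abs_le.1 (aux b (x 0) (x 1))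
    have h2 := abs_le.1 (aux c (x 0) (x 2))
    have h3 := abs_le.1 (aux c (x 1) (x 3))
    have h4 := abs_le.1 (aux b (x 2) (x 3))
    have hb := norm_nonneg b
    have hc := norm_nonneg c
    have q1 := mul_nonneg hb (add_nonneg (sq_nonneg (‖x 0‖ - ‖x 1‖)) (sq_nonneg (‖x 2‖ - ‖x 3‖)))
    have q2 := mul_nonneg hc (add_nonneg (sq_nonneg (‖x 0‖ - ‖x 2‖)) (sq_nonneg (‖x 1‖ - ‖x 3‖)))
    have q3 := mul_nonneg (sub_nonneg.2 h)
      (add_nonneg (add_nonneg (sq_nonneg ‖x 0‖) (sq_nonneg ‖x 1‖))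
        (add_nonneg (sq_nonneg ‖x 2‖) (sq_nonneg ‖x 3‖)))
    nlinarith

theorem exists_real_sqrt {s : ℝ} {d : ℂ} (h : ‖d‖ < s) :
    ∃ (r : ℝ) (z : ℂ), (r : ℂ) ^ 2 + z * star z = s ∧ 2 * r * z = d ∧
      (r ^ 2 - ‖z‖ ^ 2) ^ 2 = s ^ 2 - ‖d‖ ^ 2 := by
  have hd := norm_nonneg d
  set D := √(s ^ 2 - ‖d‖ ^ 2)
  have hD : D ^ 2 = s ^ 2 - ‖d‖ ^ 2 := Real.sq_sqrt (by nlinarith)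
  have hD0 : 0 ≤ D := Real.sqrt_nonneg _
  set r := √((s + D) / 2)
  have hr : r ^ 2 = (s + D) / 2 := Real.sq_sqrt (by linarith)
  have hr0 : 0 < r := Real.sqrt_pos.2 (by linarith)
  have hz : ‖d / (2 * r)‖ ^ 2 = (s - D) / 2 := by
    simp [abs_of_pos hr0]
    field_simp
    linear_combination hD - 2 * (s - D) * hr
  refine ⟨r, d / (2 * r), ?_, ?_, ?_⟩
  · have : d / (2 * r) * star (d / (2 * r)) = ((‖d / (2 * r)‖ ^ 2 : ℝ) : ℂ) := by
      push_cast; exact Complex.mul_conj' (d / (2 * r))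
    rw [this, hz]
    norm_cast
    rw [hr]; ring_nf
  · have : (r : ℂ) ≠ 0 := by exact_mod_cast hr0.ne'
    field_simp
  · rw [hz, hr]; linear_combination hD

theorem det_complex_prod (p q u v : ℂ) :
    LinearMap.det ((Matrix.toLin (.finTwoProd ℂ) (.finTwoProd ℂ) !![p, q; u, v]).restrictScalars ℝ)
      = ‖p * v - q * u‖ ^ 2 := by
  rw [LinearMap.det_restrictScalars, LinearMap.det_toLin, det_fin_two]
  simp [Algebra.norm_complex_eq, Complex.normSq_eq_norm_sq]

theorem lintegral_sq_sub_norm_sq {s : ℝ} (hs : 0 < s) :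
    ∫⁻ z : ℂ, ENNReal.ofReal ((Set.Iio s).indicator (fun r => s ^ 2 - r ^ 2) ‖z‖)
      = ENNReal.ofReal (π * s ^ 4 / 2) := by
  have hcont : ContinuousOn (fun r : ℝ => r ^ (Module.finrank ℝ ℂ - 1) • (s ^ 2 - r ^ 2))
      (Set.uIcc 0 s) := by
    fun_prop
  have hset : ∀ y : ℝ, y ^ (Module.finrank ℝ ℂ - 1) • (Set.Iio s).indicator (fun r => s ^ 2 - r ^ 2) y =
      (Set.Iio s).indicator (fun r => r ^ (Module.finrank ℝ ℂ - 1) • (s ^ 2 - r ^ 2)) y := by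
    intro y
    by_cases h : y < s <;> simp [h]
  rw [← ofReal_integral_eq_lintegral_ofReal,
      integral_fun_norm_addHaar (μ := (volume : Measure ℂ))
      (f := (Set.Iio s).indicator (fun r => s ^ 2 - r ^ 2))]
  · simp_rw [hset]
    rw [setIntegral_indicator measurableSet_Iio, Set.Ioi_inter_Iio, ← integral_Ioc_eq_integral_Ioo,
      ← intervalIntegral.integral_of_le hs.le]
    have : ∀ x : ℝ, x ^ (2 - 1) • (s ^ 2 - x ^ 2) = s ^ 2 * x - x ^ 3 := fun x => by
      simp; ring
    simp only [Complex.finrank_real_complex, this]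
    rw [intervalIntegral.integral_sub
      (Continuous.intervalIntegrable (by fun_prop) _ _)
      (Continuous.intervalIntegrable (by fun_prop) _ _)]
    rw [intervalIntegral.integral_const_mul]
    congr 1
    simp [Measure.real, Complex.volume_ball]
    ring
  · rw [integrable_fun_norm_addHaar (μ := (volume : Measure ℂ))
      (f := (Set.Iio s).indicator (fun r => s ^ 2 - r ^ 2))]
    simp_rw [hset]
    rw [integrableOn_indicator_iff measurableSet_Iio, Set.inter_comm, Set.Ioi_inter_Iio]
    exact hcont.integrableOn_uIcc.mono_set (by rw [Set.uIcc_of_le hs.le]; exact Set.Ioo_subset_Icc_self)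
  · refine Filter.Eventually.of_forall fun z => ?_
    refine Set.indicator_apply_nonneg fun hz => ?_
    have : ‖z‖ < s := hz
    have := norm_nonneg z
    simp; nlinarith

theorem volume_norm_add_norm_le_one :
    volume {p : ℂ × ℂ | ‖p.1‖ + ‖p.2‖ ≤ 1} = ENNReal.ofReal (π ^ 2 / 6) := by
  have h := Complex.volume_sum_rpow_le (ι := Fin 2) (p := 1) le_rfl 1
  rw [← (volume_preserving_finTwoArrow ℂ).measure_preimage_equiv]
  convert h using 1
  · congr 1
    ext x
    simp [Fin.sum_univ_two]
  · have h3 : Real.Gamma 3 = 2 := by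
      have := Real.Gamma_nat_eq_factorial 2
      norm_num [Nat.factorial, -Real.Gamma_ofNat_eq_factorial] at this
      exact this
    have h5 : Real.Gamma 5 = 24 := by
      have := Real.Gamma_nat_eq_factorial 4
      norm_num [Nat.factorial, -Real.Gamma_ofNat_eq_factorial] at this
      exact this
    norm_num [h3, h5]
    congr 1; ring

theorem lintegral_beta :
    ∫⁻ a in Set.Ioo (0 : ℝ) 1, ENNReal.ofReal (π * a ^ 4 / 2) *
      (ENNReal.ofReal (π * (1 - a) ^ 4 / 2) * ENNReal.ofReal (π ^ 2 / 6)) =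
        ENNReal.ofReal (π ^ 4 / 15120) := by
  have : ∀ a : ℝ, ENNReal.ofReal (π * a ^ 4 / 2) *
      (ENNReal.ofReal (π * (1 - a) ^ 4 / 2) * ENNReal.ofReal (π ^ 2 / 6)) =
        ENNReal.ofReal (π ^ 4 / 24 * (a ^ 4 - 4 * a ^ 5 + 6 * a ^ 6 - 4 * a ^ 7 + a ^ 8)) := by
    intro a
    rw [← ENNReal.ofReal_mul (by positivity), ← ENNReal.ofReal_mul (by positivity)]
    congr 1; ring
  simp_rw [this]
  rw [← ofReal_integral_eq_lintegral_ofReal, ← integral_Ioc_eq_integral_Ioo,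
      ← intervalIntegral.integral_of_le zero_le_one]
  · congr 1
    rw [intervalIntegral.integral_const_mul, intervalIntegral.integral_add
      (Continuous.intervalIntegrable (by fun_prop) _ _)
      (Continuous.intervalIntegrable (by fun_prop) _ _),
      intervalIntegral.integral_sub
      (Continuous.intervalIntegrable (by fun_prop) _ _)
      (Continuous.intervalIntegrable (by fun_prop) _ _),
      intervalIntegral.integral_add
      (Continuous.intervalIntegrable (by fun_prop) _ _)
      (Continuous.intervalIntegrable (by fun_prop) _ _),
      intervalIntegral.integral_sub
      (Continuous.intervalIntegrable (by fun_prop) _ _)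
      (Continuous.intervalIntegrable (by fun_prop) _ _)]
    simp
    ring
  · exact (Continuous.integrableOn_Icc (by fun_prop)).mono_set Set.Ioo_subset_Icc_self
  · refine Filter.Eventually.of_forall fun a => ?_
    have : a ^ 4 - 4 * a ^ 5 + 6 * a ^ 6 - 4 * a ^ 7 + a ^ 8 = a ^ 4 * (1 - a) ^ 4 := by ring
    simp only [this]
    positivity

theorem volume_blockMat_posSemidef {s t : ℝ} {d e : ℂ} (hd : ‖d‖ < s) (he : ‖e‖ < t) :
    volume {p : ℂ × ℂ | (blockMat s t d e p.1 p.2).PosSemidef} =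
      ENNReal.ofReal (s ^ 2 - ‖d‖ ^ 2) *
        (ENNReal.ofReal (t ^ 2 - ‖e‖ ^ 2) * ENNReal.ofReal (π ^ 2 / 6)) := by
  obtain ⟨r, z, hrs, hrd, hr⟩ := exists_real_sqrt hd
  obtain ⟨q, w, hqt, hqe, hq⟩ := exists_real_sqrt he
  have hs0 : 0 < s ^ 2 - ‖d‖ ^ 2 := by nlinarith [norm_nonneg d]
  have ht0 : 0 < t ^ 2 - ‖e‖ ^ 2 := by nlinarith [norm_nonneg e]
  have hzz : z * star z = (‖z‖ : ℂ) ^ 2 := Complex.mul_conj' z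
  have hww : w * star w = (‖w‖ : ℂ) ^ 2 := Complex.mul_conj' w
  have hdz : (r : ℂ) * r - z * star z = ((r ^ 2 - ‖z‖ ^ 2 : ℝ) : ℂ) := by
    rw [hzz]; push_cast; ring
  have hdw : (q : ℂ) * q - w * star w = ((q ^ 2 - ‖w‖ ^ 2 : ℝ) : ℂ) := by
    rw [hww]; push_cast; ring
  let κ : ℂ × ℂ →ₗ[ℝ] ℂ × ℂ := LinearMap.prodMap LinearMap.id Complex.conjAe.toLinearMap
  let g : ℂ × ℂ →ₗ[ℝ] ℂ × ℂ :=
    (Matrix.toLin (.finTwoProd ℂ) (.finTwoProd ℂ) !![(r : ℂ), -z; -star z, r]).restrictScalars ℝ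
  let k : ℂ × ℂ →ₗ[ℝ] ℂ × ℂ :=
    (Matrix.toLin (.finTwoProd ℂ) (.finTwoProd ℂ) !![(q : ℂ), star w; w, q]).restrictScalars ℝ
  have hκ : LinearMap.det κ * LinearMap.det κ = 1 := by
    rw [← LinearMap.det_comp]
    convert LinearMap.det_id (A := ℝ) (M := ℂ × ℂ)
    ext <;> simp [κ]
  have hg : LinearMap.det g = s ^ 2 - ‖d‖ ^ 2 := by
    have : (r : ℂ) * r - -z * -star z = ((r ^ 2 - ‖z‖ ^ 2 : ℝ) : ℂ) := by rw [← hdz]; ring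
    rw [det_complex_prod, this, Complex.norm_real, Real.norm_eq_abs, sq_abs, hr]
  have hk : LinearMap.det k = t ^ 2 - ‖e‖ ^ 2 := by
    have : (q : ℂ) * q - star w * w = ((q ^ 2 - ‖w‖ ^ 2 : ℝ) : ℂ) := by rw [← hdw]; ring
    rw [det_complex_prod, this, Complex.norm_real, Real.norm_eq_abs, sq_abs, hq]
  let f := k ∘ₗ κ ∘ₗ g ∘ₗ κ
  have hf : LinearMap.det f = (s ^ 2 - ‖d‖ ^ 2) * (t ^ 2 - ‖e‖ ^ 2) := by
    simp only [f, LinearMap.det_comp, hg, hk]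
    linear_combination (s ^ 2 - ‖d‖ ^ 2) * (t ^ 2 - ‖e‖ ^ 2) * hκ
  have hfa (b c : ℂ) : f (b, c) = (q * (r * b - z * star c) + star w * (r * c - z * star b),
      w * (r * b - z * star c) + q * (r * c - z * star b)) := by
    simp [f, k, κ, g, Matrix.toLin_finTwoProd_apply]
    constructor <;> ring
  let R : Matrix (Fin 4) (Fin 4) ℂ :=
    !![(r : ℂ), 0, 0, z; 0, q, w, 0; 0, star w, q, 0; star z, 0, 0, r]
  have hR : IsUnit R := by
    rw [Matrix.isUnit_iff_isUnit_det, isUnit_iff_ne_zero]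
    have : R.det = ((r : ℂ) * r - z * star z) * ((q : ℂ) * q - w * star w) := by
      simp [R, det_succ_row_zero, Fin.sum_univ_succ, Fin.succAbove]
      ring
    rw [this, hdz, hdw]
    have h1 : r ^ 2 - ‖z‖ ^ 2 ≠ 0 := fun h => by rw [h] at hr; linarith
    have h2 : q ^ 2 - ‖w‖ ^ 2 ≠ 0 := fun h => by rw [h] at hq; linarith
    exact mul_ne_zero (by exact_mod_cast h1) (by exact_mod_cast h2)
  have hconj (b c : ℂ) : blockMat s t d e (f (b, c)).1 (f (b, c)).2
      = R * blockMat 1 1 0 0 b c * star R := by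
    rw [hfa]
    simp only [blockMat, ← hrs, ← hrd, ← hqt, ← hqe]
    rw [star_eq_conjTranspose]
    ext i j
    fin_cases i <;> fin_cases j <;>
      simp [R, Matrix.mul_apply, Fin.sum_univ_succ] <;> ring
  have hpre : f ⁻¹' {p : ℂ × ℂ | (blockMat s t d e p.1 p.2).PosSemidef} =
      {p : ℂ × ℂ | ‖p.1‖ + ‖p.2‖ ≤ 1} := by
    ext ⟨b, c⟩
    simp only [Set.mem_preimage, Set.mem_ofPred_eq]
    rw [hconj, Matrix.IsUnit.posSemidef_star_right_conjugate_iff hR, blockMat_one_posSemidef_iff]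
  have hpos := mul_pos hs0 ht0
  have : (volume : Measure (ℂ × ℂ)).IsAddHaarMeasure :=
    inferInstanceAs ((volume : Measure ℂ).prod (volume : Measure ℂ)).IsAddHaarMeasure
  have := Measure.addHaar_preimage_linearMap (volume : Measure (ℂ × ℂ)) (f := f)
    (by rw [hf]; exact hpos.ne') {p : ℂ × ℂ | (blockMat s t d e p.1 p.2).PosSemidef}
  rw [hpre, volume_norm_add_norm_le_one, hf, abs_of_pos (inv_pos.2 hpos)] at this
  rw [this, ← mul_assoc, ← mul_assoc, ← ENNReal.ofReal_mul hs0.le, ← ENNReal.ofReal_mul hpos.le,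
    mul_inv_cancel₀ hpos.ne', ENNReal.ofReal_one, one_mul]

theorem blockMat_section_volume {s t : ℝ} {d e : ℂ} (hs : 0 ≤ s) (ht : 0 ≤ t)
    (hd : ‖d‖ ≠ s) (he : ‖e‖ ≠ t) :
    volume {p : ℂ × ℂ | (blockMat s t d e p.1 p.2).PosSemidef} =
      ENNReal.ofReal ((Set.Iio s).indicator (fun r => s ^ 2 - r ^ 2) ‖d‖) *
        (ENNReal.ofReal ((Set.Iio t).indicator (fun r => t ^ 2 - r ^ 2) ‖e‖) *
          ENNReal.ofReal (π ^ 2 / 6)) := by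
  by_cases h : ‖d‖ < s ∧ ‖e‖ < t
  · rw [volume_blockMat_posSemidef h.1 h.2]
    simp [h.1, h.2]
  · have : {p : ℂ × ℂ | (blockMat s t d e p.1 p.2).PosSemidef} = ∅ := by
      refine Set.eq_empty_of_forall_notMem fun p hp => h ?_
      have := norm_le_of_blockMat_posSemidef hs ht hp
      exact ⟨this.1.lt_of_ne hd, this.2.lt_of_ne he⟩
    rw [this, measure_empty]
    rw [not_and_or] at h
    rcases h with h | h <;> simp [h]

theorem lintegral_blockMat_section {s t : ℝ} (hs : 0 < s) (ht : 0 < t) :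
    ∫⁻ d : ℂ, ∫⁻ e : ℂ, volume {p : ℂ × ℂ | (blockMat s t d e p.1 p.2).PosSemidef} =
      ENNReal.ofReal (π * s ^ 4 / 2) *
        (ENNReal.ofReal (π * t ^ 4 / 2) * ENNReal.ofReal (π ^ 2 / 6)) := by
  have hne (r : ℝ) : ∀ᵐ z : ℂ, ‖z‖ ≠ r := by
    have := Measure.addHaar_sphere (volume : Measure ℂ) 0 r
    rw [measure_eq_zero_iff_ae_notMem] at this
    simpa using this
  have hmeas (r : ℝ) : Measurable fun z : ℂ =>
      ENNReal.ofReal ((Set.Iio r).indicator (fun x => r ^ 2 - x ^ 2) ‖z‖) := by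
    have : Measurable ((Set.Iio r).indicator fun x : ℝ => r ^ 2 - x ^ 2) :=
      Measurable.indicator (by fun_prop) measurableSet_Iio
    exact ENNReal.measurable_ofReal.comp (this.comp measurable_norm)
  have hin : ∀ᵐ d : ℂ, ∫⁻ e : ℂ, volume {p : ℂ × ℂ | (blockMat s t d e p.1 p.2).PosSemidef} =
      ENNReal.ofReal ((Set.Iio s).indicator (fun r => s ^ 2 - r ^ 2) ‖d‖) *
        (ENNReal.ofReal (π * t ^ 4 / 2) * ENNReal.ofReal (π ^ 2 / 6)) := by
    filter_upwards [hne s] with d hd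
    rw [← lintegral_sq_sub_norm_sq ht, ← lintegral_mul_const _ (hmeas t),
      ← lintegral_const_mul _ ((hmeas t).mul_const _)]
    refine lintegral_congr_ae ?_
    filter_upwards [hne t] with e he
    exact blockMat_section_volume hs.le ht.le hd he
  rw [lintegral_congr_ae hin, lintegral_mul_const _ (hmeas s), lintegral_sq_sub_norm_sq hs]

theorem choiMatUnital_eq_blockMat (a : ℝ) (b c d e : ℂ) :
    choiMatUnital a b c d e = blockMat a (1 - a) d e b c := by
  simp [choiMatUnital, blockMat]

theorem isClosed_setOf_blockMat_posSemidef :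
    IsClosed {p : (ℝ × ℂ × ℂ) × (ℂ × ℂ) | p.1.1 ∈ Set.Icc (0 : ℝ) 1 ∧
      (blockMat p.1.1 (1 - p.1.1) p.1.2.1 p.1.2.2 p.2.1 p.2.2).PosSemidef} := by
  have hc : Continuous fun p : (ℝ × ℂ × ℂ) × (ℂ × ℂ) =>
      blockMat p.1.1 (1 - p.1.1) p.1.2.1 p.1.2.2 p.2.1 p.2.2 := by
    refine continuous_matrix fun i j => ?_
    fin_cases i <;> fin_cases j <;> simp [blockMat] <;> fun_prop
  refine (isClosed_Icc.preimage (by fun_prop)).inter ?_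
  have hset : {p : (ℝ × ℂ × ℂ) × (ℂ × ℂ) |
      (blockMat p.1.1 (1 - p.1.1) p.1.2.1 p.1.2.2 p.2.1 p.2.2).PosSemidef} =
      ⋂ x : Fin 4 → ℂ, {p | 0 ≤ star x ⬝ᵥ
        (blockMat p.1.1 (1 - p.1.1) p.1.2.1 p.1.2.2 p.2.1 p.2.2 *ᵥ x)} := by
    ext p
    rw [Set.mem_iInter]
    exact posSemidef_iff_dotProduct_mulVec.trans (and_iff_right (blockMat_isHermitian _ _ _ _ _ _))
  change IsClosed {p : (ℝ × ℂ × ℂ) × (ℂ × ℂ) |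
      (blockMat p.1.1 (1 - p.1.1) p.1.2.1 p.1.2.2 p.2.1 p.2.2).PosSemidef}
  rw [hset]
  exact isClosed_iInter fun x => isClosed_le continuous_const
    (continuous_const.dotProduct (hc.matrix_mulVec continuous_const))

/-- Regrouping the coordinates `(a, b, c, d, e)` as `((a, d, e), (b, c))`. -/
theorem exists_measurePreserving_regroup :
    ∃ φ : ℝ × ℂ × ℂ × ℂ × ℂ → (ℝ × ℂ × ℂ) × (ℂ × ℂ), MeasurePreserving φ volume volume ∧
      ∀ a b c d e, φ (a, b, c, d, e) = ((a, d, e), (b, c)) := by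
  have h1 : MeasurePreserving (
      MeasurableEquiv.prodAssoc.symm : ℂ × ℂ × (ℂ × ℂ) ≃ᵐ (ℂ × ℂ) × (ℂ × ℂ)) volume volume :=
    volume_preserving_prodAssoc.symm
  have h2 : MeasurePreserving (Prod.swap : (ℂ × ℂ) × (ℂ × ℂ) → (ℂ × ℂ) × (ℂ × ℂ)) volume volume :=
    Measure.measurePreserving_swap
  have h3 : MeasurePreserving (MeasurableEquiv.prodAssoc.symm :
      ℝ × (ℂ × ℂ) × (ℂ × ℂ) ≃ᵐ (ℝ × ℂ × ℂ) × (ℂ × ℂ)) volume volume :=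
    volume_preserving_prodAssoc.symm
  exact ⟨_, h3.comp ((MeasurePreserving.id (volume : Measure ℝ)).prod (h2.comp h1)),
    fun _ _ _ _ _ => rfl⟩

/-- The volume of the space of unital qubit channels is `8π⁴/945`: `2⁷` times the
9-dimensional Lebesgue measure of the parameter set
`{(a,b,c,d,e) ∈ [0,1] × ℂ⁴ : the Choi matrix is positive semidefinite}`
equals `8π⁴/945`. -/
theorem volume_unital_qubit_channels :
    2 ^ 7 * volume {p : ℝ × ℂ × ℂ × ℂ × ℂ |
        p.1 ∈ Set.Icc (0 : ℝ) 1 ∧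
        (choiMatUnital p.1 p.2.1 p.2.2.1 p.2.2.2.1 p.2.2.2.2).PosSemidef}
      = ENNReal.ofReal (8 * π ^ 4 / 945) := by
  obtain ⟨φ, hφ, hφa⟩ := exists_measurePreserving_regroup
  set T := {p : (ℝ × ℂ × ℂ) × (ℂ × ℂ) | p.1.1 ∈ Set.Icc (0 : ℝ) 1 ∧
      (blockMat p.1.1 (1 - p.1.1) p.1.2.1 p.1.2.2 p.2.1 p.2.2).PosSemidef} with hT
  have hTm : MeasurableSet T := isClosed_setOf_blockMat_posSemidef.measurableSet
  have hpre : {p : ℝ × ℂ × ℂ × ℂ × ℂ | p.1 ∈ Set.Icc (0 : ℝ) 1 ∧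
      (choiMatUnital p.1 p.2.1 p.2.2.1 p.2.2.2.1 p.2.2.2.2).PosSemidef} = φ ⁻¹' T := by
    ext ⟨a, b, c, d, e⟩
    simp [hφa, hT, choiMatUnital_eq_blockMat]
  have hsec := measurable_measure_prodMk_left (ν := (volume : Measure (ℂ × ℂ))) hTm
  have hslice (a : ℝ) (ha : a ≠ 0 ∧ a ≠ 1) :
      ∫⁻ d : ℂ, ∫⁻ e : ℂ, volume (Prod.mk (a, d, e) ⁻¹' T) =
      (Set.Ioo (0 : ℝ) 1).indicator (fun a => ENNReal.ofReal (π * a ^ 4 / 2) *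
        (ENNReal.ofReal (π * (1 - a) ^ 4 / 2) * ENNReal.ofReal (π ^ 2 / 6))) a := by
    by_cases h : a ∈ Set.Ioo (0 : ℝ) 1
    · rw [Set.indicator_of_mem h, ← lintegral_blockMat_section h.1 (sub_pos.2 h.2)]
      have h' := Set.Ioo_subset_Icc_self h
      simp only [hT, Set.preimage_ofPred_eq, h', true_and]
    · have h' : a ∉ Set.Icc (0 : ℝ) 1 := fun h' =>
        h ⟨h'.1.lt_of_ne ha.1.symm, h'.2.lt_of_ne ha.2⟩
      simp only [hT, Set.preimage_ofPred_eq, h', Set.indicator_of_notMem h, false_and]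
      simp
  have hae : ∀ᵐ a : ℝ, a ≠ 0 ∧ a ≠ 1 :=
    (Measure.ae_ne volume 0).and (Measure.ae_ne volume 1)
  have hvol : volume T = ENNReal.ofReal (π ^ 4 / 15120) := by
    rw [Measure.volume_eq_prod, Measure.prod_apply hTm, Measure.volume_eq_prod,
      lintegral_prod _ hsec.aemeasurable, ← lintegral_beta, ← lintegral_indicator measurableSet_Ioo]
    refine lintegral_congr_ae ?_
    filter_upwards [hae] with a ha
    rw [← hslice a ha, Measure.volume_eq_prod, lintegral_prod]
    exact (hsec.comp (measurable_prodMk_left (x := a))).aemeasurable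
  rw [hpre, hφ.measure_preimage hTm.nullMeasurableSet, hvol,
    show (2 : ENNReal) ^ 7 = ENNReal.ofReal (2 ^ 7) by norm_num [ENNReal.ofReal_pow],
    ← ENNReal.ofReal_mul (by positivity)]
  congr 1; ring
end

section
/- Let μ be the uniform probability measure on the parameter set 𝒬̃ = {(a,f,b,c,d,e,g) ∈ [0,1]² × ℂ⁵ : Q(a,f,b,c,d,e,g) is positive semidefinite} ⊂ ℝ¹², i.e. 12-dimensional Lebesgue measure restricted to 𝒬̃ and normalized to total mass 1. Then the pushforward of μ under the map (a,f,b,c,d,e,g) ↦ a + f − 1 is the measure on ℝ with Lebesgue density η(z) = (20/11)·(z⁴ + 7|z|³ + 17z² + 7|z| + 1)·(1 − |z|)⁷ for z ∈ [−1,1] (and 0 outside [−1,1]). -/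
open MeasureTheory Matrix Real ComplexOrder

/-- The parameter set of general qubit channels, a Borel subset of `ℝ¹²`. -/
def qubitChannelSet : Set (ℝ × ℝ × ℂ × ℂ × ℂ × ℂ × ℂ) :=
  {p | p.1 ∈ Set.Icc (0 : ℝ) 1 ∧ p.2.1 ∈ Set.Icc (0 : ℝ) 1 ∧
    (choiMat p.1 p.2.1 p.2.2.1 p.2.2.2.1 p.2.2.2.2.1 p.2.2.2.2.2.1
      p.2.2.2.2.2.2).PosSemidef}

/-- The uniform probability measure on the set of qubit channels: normalized Lebesgue
measure restricted to the parameter set. -/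
noncomputable def uniformQubitChannel : Measure (ℝ × ℝ × ℂ × ℂ × ℂ × ℂ × ℂ) :=
  (volume qubitChannelSet)⁻¹ • volume.restrict qubitChannelSet

/-- The Choi matrix with its two diagonal blocks replaced by identity matrices. -/
def unitBlockMat (b d e g : ℂ) : Matrix (Fin 4) (Fin 4) ℂ :=
  !![1, b, 0, d;
     star b, 1, e, 0;
     0, star e, 1, g;
     star d, 0, star g, 1]

theorem Matrix.PosSemidef.norm_sq_apply_le {n : Type*} {M : Matrix n n ℂ} (hM : M.PosSemidef)
    (i j : n) : ‖M i j‖ ^ 2 ≤ (M i i).re * (M j j).re := by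
  have h := (hM.submatrix ![i, j]).det_nonneg
  have hji : M j i = star (M i j) := (hM.isHermitian.apply j i).symm
  have hi := (Complex.nonneg_iff.1 (hM.diag_nonneg (i := i))).2
  have hj := (Complex.nonneg_iff.1 (hM.diag_nonneg (i := j))).2
  simp only [det_fin_two, submatrix_apply, cons_val_zero, cons_val_one, hji] at h
  have h' := (Complex.nonneg_iff.1 h).1
  simp [← hi, ← hj] at h'
  rw [Complex.sq_norm, Complex.normSq_apply]
  exact h'

theorem isClosed_setOf_posSemidef (n : Type*) [Fintype n] :
    IsClosed {M : Matrix n n ℂ | M.PosSemidef} := by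
  simp only [posSemidef_iff_dotProduct_mulVec, Set.ofPred_and, Set.ofPred_forall]
  refine .inter ?_ (isClosed_iInter fun x => ?_)
  · exact isClosed_eq (by fun_prop) (by fun_prop)
  · exact isClosed_le (by fun_prop) (by fun_prop)

theorem continuous_choiMat : Continuous fun p : ℝ × ℝ × ℂ × ℂ × ℂ × ℂ × ℂ =>
    choiMat p.1 p.2.1 p.2.2.1 p.2.2.2.1 p.2.2.2.2.1 p.2.2.2.2.2.1 p.2.2.2.2.2.2 := by
  refine continuous_matrix fun i j => ?_
  fin_cases i <;> fin_cases j <;> simp [choiMat] <;> fun_prop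

theorem measurableSet_qubitChannelSet : MeasurableSet qubitChannelSet := by
  refine IsClosed.measurableSet ?_
  refine (isClosed_Icc.preimage continuous_fst).inter
    ((isClosed_Icc.preimage (continuous_fst.comp continuous_snd)).inter
      ((isClosed_setOf_posSemidef _).preimage continuous_choiMat))

/-- The parameters `(b, d, e, g)` for which `unitBlockMat` is positive semidefinite. -/
def unitBlockSet : Set (ℂ × ℂ × ℂ × ℂ) :=
  {x | (unitBlockMat x.1 x.2.1 x.2.2.1 x.2.2.2).PosSemidef}

instance isAddHaarMeasure_volume_complex_prod :
    (volume : Measure (ℂ × ℂ × ℂ × ℂ)).IsAddHaarMeasure :=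
  have : (volume : Measure (ℂ × ℂ)).IsAddHaarMeasure :=
    Measure.prod.instIsAddHaarMeasure volume volume
  have : (volume : Measure (ℂ × ℂ × ℂ)).IsAddHaarMeasure :=
    Measure.prod.instIsAddHaarMeasure volume volume
  Measure.prod.instIsAddHaarMeasure volume volume

theorem volume_unitBlockSet_ne_top : volume unitBlockSet ≠ ⊤ := by
  refine ne_top_of_le_ne_top (b := volume (Metric.closedBall (0 : ℂ × ℂ × ℂ × ℂ) 1))
    measure_closedBall_lt_top.ne (measure_mono fun x hx => ?_)
  have h (i j) := Matrix.PosSemidef.norm_sq_apply_le hx i j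
  have h1 := h 0 1
  have h2 := h 0 3
  have h3 := h 1 2
  have h4 := h 2 3
  simp [unitBlockMat] at h1 h2 h3 h4
  simp [Prod.norm_def, h1, h2, h3, h4]

theorem half_normSq_add_add_re_nonneg {b : ℂ} (hb : ‖b‖ ≤ 1 / 2) (x y : ℂ) :
    0 ≤ (Complex.normSq x + Complex.normSq y) / 2 + 2 * (star x * b * y).re := by
  have h : |(star x * b * y).re| ≤ ‖x‖ * (1 / 2) * ‖y‖ := by
    refine (Complex.abs_re_le_norm _).trans ?_
    rw [norm_mul, norm_mul, norm_star]
    gcongr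
  have := neg_abs_le (star x * b * y).re
  rw [← Complex.sq_norm, ← Complex.sq_norm]
  nlinarith [sq_nonneg (‖x‖ - ‖y‖)]

theorem volume_unitBlockSet_ne_zero : volume unitBlockSet ≠ 0 := by
  refine (lt_of_lt_of_le (Metric.measure_closedBall_pos volume (0 : ℂ × ℂ × ℂ × ℂ)
    (by norm_num : (0 : ℝ) < 1 / 2)) (measure_mono fun x hx => ?_)).ne'
  obtain ⟨b, d, e, g⟩ := x
  simp only [Metric.mem_closedBall, dist_zero_right, Prod.norm_def, sup_le_iff] at hx
  obtain ⟨hb, hd, he, hg⟩ := hx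
  refine PosSemidef.of_dotProduct_mulVec_nonneg ?_ fun x => Complex.nonneg_iff.2 ?_
  · ext i j
    fin_cases i <;> fin_cases j <;> simp [unitBlockMat]
  · have h1 := half_normSq_add_add_re_nonneg hb (x 0) (x 1)
    have h2 := half_normSq_add_add_re_nonneg hd (x 0) (x 3)
    have h3 := half_normSq_add_add_re_nonneg he (x 1) (x 2)
    have h4 := half_normSq_add_add_re_nonneg hg (x 2) (x 3)
    simp [Complex.normSq_apply] at h1 h2 h3 h4
    simp [unitBlockMat, mulVec, dotProduct, Fin.sum_univ_four]
    constructor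
    · linarith
    · ring

/-- The coordinates of `ℂ⁴` with the third one conjugated, as a real-linear equivalence. -/
noncomputable def conjThirdEquiv : (Fin 4 → ℂ) ≃ₗ[ℝ] ℂ × ℂ × ℂ × ℂ where
  toFun v := (v 0, v 1, star (v 2), v 3)
  invFun x := ![x.1, x.2.1, star x.2.2.1, x.2.2.2]
  map_add' v w := by simp
  map_smul' r v := by simp
  left_inv v := by ext i; fin_cases i <;> simp
  right_inv x := by simp

theorem det_conjThirdEquiv_conj_toLin (A : Matrix (Fin 4) (Fin 4) ℂ) :
    LinearMap.det (conjThirdEquiv.toLinearMap ∘ₗ (toLin' A).restrictScalars ℝ ∘ₗ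
      conjThirdEquiv.symm.toLinearMap) = Complex.normSq A.det := by
  rw [LinearMap.det_conj, LinearMap.det_restrictScalars, LinearMap.det_toLin',
    Algebra.norm_complex_apply]

theorem exists_cholesky_two {a f : ℝ} {c : ℂ} (ha : 0 < a) (hc : ‖c‖ ^ 2 < a * f) :
    ∃ (x z : ℝ) (y : ℂ), 0 < x ∧ 0 < z ∧ x ^ 2 = a ∧ x * star y = c ∧ ‖y‖ ^ 2 + z ^ 2 = f := by
  have hsa : (√a : ℂ) ≠ 0 := by exact_mod_cast (Real.sqrt_pos.2 ha).ne'
  have hz : 0 < f - ‖c‖ ^ 2 / a := by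
    rw [sub_pos, div_lt_iff₀ ha]; linarith
  refine ⟨√a, √(f - ‖c‖ ^ 2 / a), star c / √a, Real.sqrt_pos.2 ha, Real.sqrt_pos.2 hz,
    Real.sq_sqrt ha.le, ?_, ?_⟩
  · simp; field_simp
  · rw [Real.sq_sqrt hz.le, norm_div, div_pow, norm_star, Complex.norm_real, Real.norm_eq_abs,
      sq_abs, Real.sq_sqrt ha.le]
    ring

theorem volume_choiMat_fiber {a f : ℝ} {c : ℂ} (ha : 0 < a) (ha' : a < 1)
    (h : ‖c‖ ^ 2 < a * f) (h' : ‖c‖ ^ 2 < (1 - a) * (1 - f)) :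
    volume {x : ℂ × ℂ × ℂ × ℂ | (choiMat a f x.1 c x.2.1 x.2.2.1 x.2.2.2).PosSemidef} =
      ENNReal.ofReal (((a * f - ‖c‖ ^ 2) * ((1 - a) * (1 - f) - ‖c‖ ^ 2)) ^ 2) *
        volume unitBlockSet := by
  obtain ⟨x, z, y, hx, hz, hxa, hxy, hyz⟩ := exists_cholesky_two ha h
  obtain ⟨u, w, v, hu, hw, hua, huv, hvw⟩ :=
    exists_cholesky_two (c := -c) (sub_pos.2 ha') (by simpa using h')
  have hyz' : y * star y + z ^ 2 = f := by
    rw [← hyz, ← starRingEnd_apply, Complex.mul_conj']; push_cast; rfl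
  have hvw' : v * star v + w ^ 2 = 1 - f := by
    have : ((1 - f : ℝ) : ℂ) = 1 - f := by push_cast; rfl
    rw [← this, ← hvw, ← starRingEnd_apply, Complex.mul_conj']; push_cast; rfl
  have hxa' : (x : ℂ) ^ 2 = a := by rw [← hxa]; push_cast; rfl
  have hua' : (u : ℂ) ^ 2 = 1 - a := by
    rw [← Complex.ofReal_pow, hua]; push_cast; rfl
  have hyx : x * y = star c := by rw [← hxy]; simp
  have hvu : u * v = -star c := by rw [← star_neg, ← huv]; simp
  set A : Matrix (Fin 4) (Fin 4) ℂ :=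
    !![x * u, 0, 0, 0;
       x * star v, x * w, 0, 0;
       y * u, 0, z * u, 0;
       y * star v, y * w, z * star v, z * w] with hA
  have hdetA : A.det = ((x * u * z * w) ^ 2 : ℝ) := by
    simp [hA, det_succ_row_zero, Fin.sum_univ_succ, Fin.succAbove]
    ring
  set T := conjThirdEquiv.toLinearMap ∘ₗ (toLin' A).restrictScalars ℝ ∘ₗ
      conjThirdEquiv.symm.toLinearMap with hT
  have hdetT : LinearMap.det T = ((a * f - ‖c‖ ^ 2) * ((1 - a) * (1 - f) - ‖c‖ ^ 2)) ^ 2 := by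
    have h1 : a * f - ‖c‖ ^ 2 = (x * z) ^ 2 := by
      rw [← hyz, ← hxa, ← hxy, norm_mul, norm_star, Complex.norm_real, mul_pow, Real.norm_eq_abs,
        sq_abs]
      ring
    have h2 : (1 - a) * (1 - f) - ‖c‖ ^ 2 = (u * w) ^ 2 := by
      rw [← hvw, ← hua, ← norm_neg c, ← huv, norm_mul, norm_star, Complex.norm_real, mul_pow,
        Real.norm_eq_abs, sq_abs]
      ring
    rw [hT, det_conjThirdEquiv_conj_toLin, hdetA, Complex.normSq_ofReal, h1, h2]
    ring
  have hpos : 0 < LinearMap.det T := by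
    rw [hdetT]
    have := sub_pos.2 h
    have := sub_pos.2 h'
    positivity
  set W : Matrix (Fin 4) (Fin 4) ℂ :=
    !![x, 0, 0, 0;
       0, u, 0, 0;
       y, 0, z, 0;
       0, v, 0, w] with hW
  have hdetW : W.det = ((x * u * z * w : ℝ) : ℂ) := by
    simp [hW, det_succ_row_zero, Fin.sum_univ_succ, Fin.succAbove]
    ring
  have hWu : IsUnit W := by
    rw [isUnit_iff_isUnit_det, hdetW, isUnit_iff_ne_zero]
    exact_mod_cast (by positivity : x * u * z * w ≠ 0)
  have key (p : ℂ × ℂ × ℂ × ℂ) : choiMat a f (T p).1 c (T p).2.1 (T p).2.2.1 (T p).2.2.2 =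
      W * unitBlockMat p.1 p.2.1 p.2.2.1 p.2.2.2 * star W := by
    obtain ⟨b, d, e, g⟩ := p
    have hTp : T (b, d, e, g) = (x * u * b, x * star v * b + x * w * d,
        star (y * u * b + z * u * star e),
        y * star v * b + y * w * d + z * star v * star e + z * w * g) := by
      simp [hT, conjThirdEquiv, hA, mulVec, dotProduct, Fin.sum_univ_four]
    rw [hTp]
    simp only [← starRingEnd_apply] at hyz' hvw' hyx hvu hxy huv
    ext i j
    fin_cases i <;> fin_cases j <;>
      simp [choiMat, unitBlockMat, hW, Matrix.mul_apply, Fin.sum_univ_four, star_apply] <;>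
      first
        | ring1
        | linear_combination -hxa'
        | linear_combination -hua'
        | linear_combination -hxy
        | linear_combination -huv
        | linear_combination -hyx
        | linear_combination -hvu
        | linear_combination -hyz'
        | linear_combination -hvw'
  have hpre : T ⁻¹' {p | (choiMat a f p.1 c p.2.1 p.2.2.1 p.2.2.2).PosSemidef} =
      unitBlockSet := by
    ext p
    simp only [Set.mem_preimage, Set.mem_ofPred_eq, unitBlockSet]
    rw [key, hWu.posSemidef_star_right_conjugate_iff]
  rw [← hpre, Measure.addHaar_preimage_linearMap _ hpos.ne', ← hdetT, ← mul_assoc,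
    ← ENNReal.ofReal_mul hpos.le, abs_of_pos (inv_pos.2 hpos), mul_inv_cancel₀ hpos.ne']
  simp

theorem intervalIntegral_sum_mul_pow {n : ℕ} (c : Fin n → ℝ) (s : ℝ) :
    ∫ x in (0 : ℝ)..s, ∑ i, c i * x ^ (i : ℕ) = ∑ i, c i * (s ^ (i + 1 : ℕ) / (i + 1)) := by
  rw [intervalIntegral.integral_finsetSum fun i _ => Continuous.intervalIntegrable (by fun_prop) _ _]
  simp

theorem integral_radial_aux {p q : ℝ} (hp : 0 ≤ p) :
    ∫ y in (0 : ℝ)..√p, y * ((p - y ^ 2) * (q - y ^ 2)) ^ 2 =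
      p ^ 5 / 10 + (q - p) * p ^ 4 / 4 + (q - p) ^ 2 * p ^ 3 / 6 := by
  have h := intervalIntegral_sum_mul_pow ![0, (p * q) ^ 2, 0, -2 * (p + q) * (p * q), 0,
    (p + q) ^ 2 + 2 * (p * q), 0, -2 * (p + q), 0, 1] √p
  have hs : √p ^ 2 = p := Real.sq_sqrt hp
  have hs4 : √p ^ 4 = p ^ 2 := by rw [← hs]; ring_nf; rw [hs]
  have hs6 : √p ^ 6 = p ^ 3 := by rw [show √p ^ 6 = (√p ^ 2) ^ 3 by ring, hs]
  have hs8 : √p ^ 8 = p ^ 4 := by rw [show √p ^ 8 = (√p ^ 2) ^ 4 by ring, hs]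
  have hs10 : √p ^ 10 = p ^ 5 := by rw [show √p ^ 10 = (√p ^ 2) ^ 5 by ring, hs]
  simp only [Fin.sum_univ_succ] at h
  simp [hs, hs4, hs6, hs8, hs10] at h
  refine Eq.trans (intervalIntegral.integral_congr fun y _ => ?_) (h.trans ?_)
  · ring
  · ring

theorem integral_radial {p q : ℝ} (hp : 0 ≤ p) (hq : 0 ≤ q) :
    ∫ y in (0 : ℝ)..√(min p q), y * ((p - y ^ 2) * (q - y ^ 2)) ^ 2 =
      min p q ^ 5 / 10 + |p - q| * min p q ^ 4 / 4 + |p - q| ^ 2 * min p q ^ 3 / 6 := by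
  rcases le_total p q with h | h
  · rw [min_eq_left h, integral_radial_aux hp, abs_sub_comm, abs_of_nonneg (sub_nonneg.2 h)]
  · rw [min_eq_right h, abs_of_nonneg (sub_nonneg.2 h), ← integral_radial_aux hq]
    simp only [mul_comm]

theorem lintegral_radial {p q : ℝ} (hp : 0 ≤ p) (hq : 0 ≤ q) :
    ∫⁻ c : ℂ, (if ‖c‖ ^ 2 < min p q then
        ENNReal.ofReal (((p - ‖c‖ ^ 2) * (q - ‖c‖ ^ 2)) ^ 2) else 0) =
      ENNReal.ofReal (2 * volume.real (Metric.ball (0 : ℂ) 1)) *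
        ENNReal.ofReal (min p q ^ 5 / 10 + |p - q| * min p q ^ 4 / 4
          + |p - q| ^ 2 * min p q ^ 3 / 6) := by
  set F : ℝ → ℝ := fun y => if y ^ 2 < min p q then ((p - y ^ 2) * (q - y ^ 2)) ^ 2 else 0 with hF
  have hF0 (y : ℝ) : 0 ≤ F y := by
    simp only [hF]; split_ifs <;> positivity
  have hind : Set.EqOn (fun y => y * F y)
      ((Set.Ioo 0 √(min p q)).indicator fun y => y * ((p - y ^ 2) * (q - y ^ 2)) ^ 2)
      (Set.Ioi 0) := by
    intro y (hy : 0 < y)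
    simp only [hF, Set.indicator, Set.mem_Ioo, hy, true_and, Real.lt_sqrt hy.le]
    split_ifs <;> simp
  have hcont : Continuous fun y : ℝ => y * ((p - y ^ 2) * (q - y ^ 2)) ^ 2 := by fun_prop
  have hint : Integrable (fun c : ℂ => F ‖c‖) := by
    rw [integrable_fun_norm_addHaar (μ := volume) (f := F), Complex.finrank_real_complex]
    simp only [Nat.add_one_sub_one, pow_one, smul_eq_mul]
    rw [integrableOn_congr_fun hind measurableSet_Ioi]
    refine Integrable.integrableOn ((integrable_indicator_iff measurableSet_Ioo).2 ?_)
    exact (hcont.integrableOn_Icc (a := 0) (b := √(min p q))).mono_set Set.Ioo_subset_Icc_self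
  have hval : ∫ c : ℂ, F ‖c‖ = 2 * volume.real (Metric.ball (0 : ℂ) 1) *
      (min p q ^ 5 / 10 + |p - q| * min p q ^ 4 / 4 + |p - q| ^ 2 * min p q ^ 3 / 6) := by
    rw [integral_fun_norm_addHaar, Complex.finrank_real_complex]
    simp only [Nat.add_one_sub_one, pow_one, smul_eq_mul, nsmul_eq_mul]
    rw [setIntegral_congr_fun measurableSet_Ioi hind, setIntegral_indicator measurableSet_Ioo,
      Set.inter_eq_right.2 Set.Ioo_subset_Ioi_self, ← integral_Ioc_eq_integral_Ioo,
      ← intervalIntegral.integral_of_le (Real.sqrt_nonneg _), integral_radial hp hq]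
    push_cast
    ring
  rw [← ENNReal.ofReal_mul (by positivity), ← hval,
    ofReal_integral_eq_lintegral_ofReal hint (.of_forall fun c => hF0 _)]
  refine lintegral_congr fun c => ?_
  simp only [hF]
  split_ifs <;> simp

theorem integral_beta_aux (w r : ℝ) :
    ∫ t in (0 : ℝ)..w, (((w - t) * t) ^ 5 / 10 + r * ((w - t) * t) ^ 4 / 4
        + r ^ 2 * ((w - t) * t) ^ 3 / 6) =
      w ^ 7 * (w ^ 4 + 11 * r * w ^ 2 + 33 * r ^ 2) / 27720 := by
  have h := intervalIntegral_sum_mul_pow ![0, 0, 0, r ^ 2 * w ^ 3 / 6,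
    r * w ^ 4 / 4 - r ^ 2 * w ^ 2 / 2, w ^ 5 / 10 - r * w ^ 3 + r ^ 2 * w / 2,
    - w ^ 4 / 2 + r * w ^ 2 * 3 / 2 - r ^ 2 / 6, w ^ 3 - r * w, - w ^ 2 + r / 4, w / 2, -1 / 10] w
  simp only [Fin.sum_univ_succ] at h
  simp at h
  refine Eq.trans (intervalIntegral.integral_congr fun y _ => ?_) (h.trans ?_)
  · ring
  · ring

theorem integral_beta (l u r : ℝ) :
    ∫ t in l..u, (((u - t) * (t - l)) ^ 5 / 10 + r * ((u - t) * (t - l)) ^ 4 / 4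
        + r ^ 2 * ((u - t) * (t - l)) ^ 3 / 6) =
      (u - l) ^ 7 * ((u - l) ^ 4 + 11 * r * (u - l) ^ 2 + 33 * r ^ 2) / 27720 := by
  rw [← integral_beta_aux, ← sub_self l, ← intervalIntegral.integral_comp_sub_right _ l]
  simp only [sub_sub_sub_cancel_right]

theorem integral_density :
    ∫ t in (0 : ℝ)..1, (20 / 11) * (t ^ 4 + 7 * t ^ 3 + 17 * t ^ 2 + 7 * t + 1) * (1 - t) ^ 7 =
      1 / 2 := by
  have h := intervalIntegral_sum_mul_pow
    (fun i => 20 / 11 * (![1, 0, -11, 0, 99, -231, 231, -99, 0, 11, 0, -1] i : ℝ)) 1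
  simp only [Fin.sum_univ_succ] at h
  simp at h
  refine Eq.trans (intervalIntegral.integral_congr fun y _ => ?_) (h.trans ?_)
  · ring
  · norm_num

theorem lintegral_density :
    ∫⁻ z : ℝ, (if |z| ≤ 1 then
          ENNReal.ofReal ((20 / 11) * (z ^ 4 + 7 * |z| ^ 3 + 17 * z ^ 2 + 7 * |z| + 1)
            * (1 - |z|) ^ 7)
        else 0) = 1 := by
  set F : ℝ → ℝ := (Set.Iic 1).indicator fun t =>
    (20 / 11) * (t ^ 4 + 7 * t ^ 3 + 17 * t ^ 2 + 7 * t + 1) * (1 - t) ^ 7 with hF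
  have hF0 (z : ℝ) : 0 ≤ F |z| := by
    refine Set.indicator_apply_nonneg fun h => ?_
    have := sub_nonneg.2 (Set.mem_Iic.1 h)
    positivity
  have hcont : Continuous fun t : ℝ =>
    (20 / 11) * (t ^ 4 + 7 * t ^ 3 + 17 * t ^ 2 + 7 * t + 1) * (1 - t) ^ 7 := by fun_prop
  have hint : Integrable fun z : ℝ => F |z| := by
    have : (fun z : ℝ => F |z|) = (Set.Icc (-1) 1).indicator fun z =>
        (20 / 11) * (|z| ^ 4 + 7 * |z| ^ 3 + 17 * |z| ^ 2 + 7 * |z| + 1) * (1 - |z|) ^ 7 := by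
      ext z
      simp only [hF, Set.indicator, Set.mem_Iic, Set.mem_Icc, abs_le]
    rw [this, integrable_indicator_iff measurableSet_Icc]
    exact (hcont.comp continuous_abs).integrableOn_Icc
  have hval : ∫ z : ℝ, F |z| = 1 := by
    rw [integral_comp_abs, hF, setIntegral_indicator measurableSet_Iic, Set.Ioi_inter_Iic,
      ← intervalIntegral.integral_of_le zero_le_one, integral_density]
    norm_num
  have h := ofReal_integral_eq_lintegral_ofReal hint (.of_forall hF0)
  rw [hval, ENNReal.ofReal_one] at h
  rw [h]
  refine lintegral_congr fun z => ?_
  simp only [hF, Set.indicator, Set.mem_Iic, (by decide : Even 4).pow_abs, sq_abs]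
  by_cases h : |z| ≤ 1 <;> simp [h]

theorem prod_prod_apply_lintegral_middle {α β γ : Type*} [MeasurableSpace α] [MeasurableSpace β]
    [MeasurableSpace γ] (μ : Measure α) (ν : Measure β) (ρ : Measure γ) [SFinite μ] [SFinite ν]
    [SFinite ρ] {S : Set (α × β × γ)} (hS : MeasurableSet S) :
    μ.prod (ν.prod ρ) S = ∫⁻ y, μ.prod ρ {p | (p.1, y, p.2) ∈ S} ∂ν := by
  have h1 (x : α) : ν.prod ρ (Prod.mk x ⁻¹' S) = ∫⁻ y, ρ {z | (x, y, z) ∈ S} ∂ν :=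
    Measure.prod_apply (measurable_prodMk_left hS)
  have h2 (y : β) : μ.prod ρ {p | (p.1, y, p.2) ∈ S} = ∫⁻ x, ρ {z | (x, y, z) ∈ S} ∂μ :=
    Measure.prod_apply (hS.preimage (by fun_prop : Measurable fun p : α × γ => (p.1, y, p.2)))
  simp only [Measure.prod_apply hS, h1, h2]
  refine lintegral_lintegral_swap (Measurable.aemeasurable ?_)
  exact measurable_measure_prodMk_left
    (hS.preimage (by fun_prop : Measurable fun p : (α × β) × γ => (p.1.1, p.1.2, p.2)))

theorem measurableSet_choiMat_fiber (a f : ℝ) :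
    MeasurableSet {q : ℂ × ℂ × ℂ × ℂ × ℂ |
      (choiMat a f q.1 q.2.1 q.2.2.1 q.2.2.2.1 q.2.2.2.2).PosSemidef} :=
  ((isClosed_setOf_posSemidef _).preimage (continuous_choiMat.comp
    (by fun_prop : Continuous fun q : ℂ × ℂ × ℂ × ℂ × ℂ => (a, f, q)))).measurableSet

theorem volume_choiMat_fiber_eq_zero {a f : ℝ} {c : ℂ}
    (h : min (a * f) ((1 - a) * (1 - f)) < ‖c‖ ^ 2) :
    volume {x : ℂ × ℂ × ℂ × ℂ | (choiMat a f x.1 c x.2.1 x.2.2.1 x.2.2.2).PosSemidef} = 0 := by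
  refine (measure_mono_null (t := ∅) (fun x hx => ?_) measure_empty)
  have h1 := Matrix.PosSemidef.norm_sq_apply_le hx 0 2
  have h2 := Matrix.PosSemidef.norm_sq_apply_le hx 1 3
  simp [choiMat] at h1 h2
  exact absurd (le_min h1 h2) h.not_ge

theorem volume_choiMat_section {a f : ℝ} (ha : a ∈ Set.Icc (0 : ℝ) 1) (hf : f ∈ Set.Icc (0 : ℝ) 1) :
    volume {q : ℂ × ℂ × ℂ × ℂ × ℂ |
        (choiMat a f q.1 q.2.1 q.2.2.1 q.2.2.2.1 q.2.2.2.2).PosSemidef} =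
      volume unitBlockSet * (ENNReal.ofReal (2 * volume.real (Metric.ball (0 : ℂ) 1)) *
        ENNReal.ofReal (min (a * f) ((1 - a) * (1 - f)) ^ 5 / 10
          + |a + f - 1| * min (a * f) ((1 - a) * (1 - f)) ^ 4 / 4
          + |a + f - 1| ^ 2 * min (a * f) ((1 - a) * (1 - f)) ^ 3 / 6)) := by
  have hp : 0 ≤ a * f := mul_nonneg ha.1 hf.1
  have hq : 0 ≤ (1 - a) * (1 - f) := mul_nonneg (sub_nonneg.2 ha.2) (sub_nonneg.2 hf.2)
  have habs : a + f - 1 = a * f - (1 - a) * (1 - f) := by ring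
  rw [habs, ← lintegral_radial hp hq, ← lintegral_const_mul' _ _ volume_unitBlockSet_ne_top]
  refine (prod_prod_apply_lintegral_middle volume volume volume
    (measurableSet_choiMat_fiber a f)).trans (lintegral_congr_ae ?_)
  have hsphere : ∀ᵐ c : ℂ, c ∉ Metric.sphere (0 : ℂ) √(min (a * f) ((1 - a) * (1 - f))) :=
    measure_eq_zero_iff_ae_notMem.1 (Measure.addHaar_sphere _ _ _)
  filter_upwards [hsphere] with c hc
  have hne : ‖c‖ ^ 2 ≠ min (a * f) ((1 - a) * (1 - f)) := fun h =>
    hc (by rw [← h, mem_sphere_zero_iff_norm, Real.sqrt_sq (norm_nonneg _)])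
  refine (?_ : volume {x : ℂ × ℂ × ℂ × ℂ |
    (choiMat a f x.1 c x.2.1 x.2.2.1 x.2.2.2).PosSemidef} = _)
  rcases hne.lt_or_gt with h | h
  · obtain ⟨h1, h2⟩ := lt_min_iff.1 h
    have ha0 : a ≠ 0 := by
      rintro rfl; rw [zero_mul] at h1; exact absurd h1 (sq_nonneg _).not_gt
    have ha1 : a ≠ 1 := by
      rintro rfl; rw [sub_self, zero_mul] at h2; exact absurd h2 (sq_nonneg _).not_gt
    rw [if_pos h, volume_choiMat_fiber (ha.1.lt_of_ne' ha0) (ha.2.lt_of_ne ha1) h1 h2, mul_comm]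
  · rw [if_neg h.not_gt, volume_choiMat_fiber_eq_zero h, mul_zero]

/-- The volume of the channels with prescribed `a` and `f`, up to a constant factor. -/
noncomputable def sectionDensity (a f : ℝ) : ENNReal :=
  if a ∈ Set.Icc (0 : ℝ) 1 ∧ f ∈ Set.Icc (0 : ℝ) 1 then
    ENNReal.ofReal (min (a * f) ((1 - a) * (1 - f)) ^ 5 / 10
      + |a + f - 1| * min (a * f) ((1 - a) * (1 - f)) ^ 4 / 4
      + |a + f - 1| ^ 2 * min (a * f) ((1 - a) * (1 - f)) ^ 3 / 6)
  else 0

theorem measurable_sectionDensity : Measurable (Function.uncurry sectionDensity) := by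
  refine Measurable.ite ?_ (by fun_prop) measurable_const
  exact (measurableSet_Icc.preimage measurable_fst).inter (measurableSet_Icc.preimage measurable_snd)

/-- The constant relating `sectionDensity` to the volume of sections of `qubitChannelSet`. -/
noncomputable def sectionConst : ENNReal :=
  volume unitBlockSet * ENNReal.ofReal (2 * volume.real (Metric.ball (0 : ℂ) 1))

theorem sectionConst_ne_top : sectionConst ≠ ⊤ :=
  ENNReal.mul_ne_top volume_unitBlockSet_ne_top ENNReal.ofReal_ne_top

theorem sectionConst_ne_zero : sectionConst ≠ 0 := by
  refine mul_ne_zero volume_unitBlockSet_ne_zero ?_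
  have : 0 < volume.real (Metric.ball (0 : ℂ) 1) := by
    rw [measureReal_def]
    exact ENNReal.toReal_pos (Metric.measure_ball_pos _ _ one_pos).ne' measure_ball_lt_top.ne
  exact (ENNReal.ofReal_pos.2 (by positivity)).ne'

theorem volume_qubitChannelSet_section (a f : ℝ) :
    volume {q : ℂ × ℂ × ℂ × ℂ × ℂ | (a, f, q) ∈ qubitChannelSet} =
      sectionConst * sectionDensity a f := by
  by_cases h : a ∈ Set.Icc (0 : ℝ) 1 ∧ f ∈ Set.Icc (0 : ℝ) 1
  · rw [sectionDensity, if_pos h, sectionConst, mul_assoc, ← volume_choiMat_section h.1 h.2]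
    congr 1
    ext q
    exact ⟨fun hq => hq.2.2, fun hq => ⟨h.1, h.2, hq⟩⟩
  · rw [sectionDensity, if_neg h, mul_zero]
    refine measure_mono_null (t := ∅) (fun q hq => ?_) measure_empty
    exact h ⟨hq.1, hq.2.1⟩

theorem lintegral_sectionDensity (z : ℝ) :
    ∫⁻ a, sectionDensity a (z + (1 - a)) = ENNReal.ofReal (1 / 50400) *
      (if |z| ≤ 1 then
          ENNReal.ofReal ((20 / 11) * (z ^ 4 + 7 * |z| ^ 3 + 17 * z ^ 2 + 7 * |z| + 1)
            * (1 - |z|) ^ 7)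
        else 0) := by
  obtain ⟨l, u, hlu, hmem, hmin⟩ : ∃ l u : ℝ, u - l = 1 - |z| ∧
      (∀ a, (a ∈ Set.Icc (0 : ℝ) 1 ∧ z + (1 - a) ∈ Set.Icc (0 : ℝ) 1) ↔ a ∈ Set.Icc l u) ∧
      ∀ a, min (a * (z + (1 - a))) ((1 - a) * (1 - (z + (1 - a)))) = (u - a) * (a - l) := by
    rcases le_total 0 z with hz | hz
    · refine ⟨z, 1, by rw [abs_of_nonneg hz], fun a => ?_, fun a => ?_⟩
      · simp only [Set.mem_Icc]; grind
      · rw [min_eq_right (by linarith)]; ring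
    · refine ⟨0, 1 + z, by rw [abs_of_nonpos hz]; ring, fun a => ?_, fun a => ?_⟩
      · simp only [Set.mem_Icc]; grind
      · rw [min_eq_left (by linarith)]; ring
  set G : ℝ → ℝ := fun a => ((u - a) * (a - l)) ^ 5 / 10 + |z| * ((u - a) * (a - l)) ^ 4 / 4
    + |z| ^ 2 * ((u - a) * (a - l)) ^ 3 / 6 with hG
  have hsec (a : ℝ) : sectionDensity a (z + (1 - a)) =
      (Set.Icc l u).indicator (fun a => ENNReal.ofReal (G a)) a := by
    have : a + (z + (1 - a)) - 1 = z := by ring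
    simp only [sectionDensity, hmem, hmin, this, Set.indicator, hG]
  simp only [hsec]
  rw [lintegral_indicator measurableSet_Icc]
  split_ifs with h
  · have hle : l ≤ u := by linarith
    have hG0 : ∀ a ∈ Set.Icc l u, 0 ≤ G a := by
      intro a ha
      have : 0 ≤ (u - a) * (a - l) := mul_nonneg (sub_nonneg.2 ha.2) (sub_nonneg.2 ha.1)
      positivity
    rw [← ofReal_integral_eq_lintegral_ofReal
      (Continuous.integrableOn_Icc (by fun_prop))
      ((ae_restrict_iff' measurableSet_Icc).2 (.of_forall hG0)),
      integral_Icc_eq_integral_Ioc, ← intervalIntegral.integral_of_le hle, integral_beta, hlu,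
      ← ENNReal.ofReal_mul (by norm_num), ← sq_abs z, ← (by decide : Even 4).pow_abs z]
    congr 1
    ring
  · rw [Set.Icc_eq_empty (by linarith), Measure.restrict_empty, lintegral_zero_measure, mul_zero]

theorem volume_qubitChannelSet_inter_preimage {s : Set ℝ} (hs : MeasurableSet s) :
    volume ((fun p : ℝ × ℝ × ℂ × ℂ × ℂ × ℂ × ℂ => p.1 + p.2.1 - 1) ⁻¹' s ∩ qubitChannelSet) =
      sectionConst * ∫⁻ z in s, ∫⁻ a, sectionDensity a (z + (1 - a)) := by
  have hmeas : MeasurableSet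
      ((fun p : ℝ × ℝ × ℂ × ℂ × ℂ × ℂ × ℂ => p.1 + p.2.1 - 1) ⁻¹' s ∩ qubitChannelSet) :=
    (hs.preimage (by fun_prop)).inter measurableSet_qubitChannelSet
  set S := (fun p : ℝ × ℝ × ℂ × ℂ × ℂ × ℂ × ℂ => p.1 + p.2.1 - 1) ⁻¹' s ∩ qubitChannelSet with hS
  have hsec (a f : ℝ) : volume {q : ℂ × ℂ × ℂ × ℂ × ℂ | (a, f, q) ∈ S} =
      sectionConst * s.indicator (fun _ => sectionDensity a f) (a + f - 1) := by
    by_cases h : a + f - 1 ∈ s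
    · rw [Set.indicator_of_mem h, ← volume_qubitChannelSet_section]
      simp [hS, h]
    · rw [Set.indicator_of_notMem h, mul_zero]
      simp [hS, h]
  have hshift (a : ℝ) : ∫⁻ f, s.indicator (fun _ => sectionDensity a f) (a + f - 1) =
      ∫⁻ z, s.indicator (fun z => sectionDensity a (z + (1 - a))) z := by
    rw [← lintegral_add_right_eq_self _ (1 - a)]
    refine lintegral_congr fun z => ?_
    rw [show a + (z + (1 - a)) - 1 = z by ring]
    rfl
  have hd : Measurable fun p : ℝ × ℝ => sectionDensity p.1 (p.2 + (1 - p.1)) :=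
    measurable_sectionDensity.comp
      (by fun_prop : Measurable fun p : ℝ × ℝ => (p.1, p.2 + (1 - p.1)))
  calc volume S = ∫⁻ a, ∫⁻ f, volume {q : ℂ × ℂ × ℂ × ℂ × ℂ | (a, f, q) ∈ S} := by
        refine (Measure.prod_apply hmeas).trans (lintegral_congr fun a => ?_)
        exact Measure.prod_apply (measurable_prodMk_left hmeas)
    _ = sectionConst * ∫⁻ a, ∫⁻ z, s.indicator (fun z => sectionDensity a (z + (1 - a))) z := by
        simp only [hsec, lintegral_const_mul' _ _ sectionConst_ne_top, hshift]
    _ = sectionConst * ∫⁻ z in s, ∫⁻ a, sectionDensity a (z + (1 - a)) := by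
        simp only [lintegral_indicator hs]
        rw [lintegral_lintegral_swap hd.aemeasurable]

/-- The `z`-component `a + f − 1` of the image of the maximally mixed state under a
uniformly random qubit channel has Lebesgue density
`η(z) = (20/11)(z⁴ + 7|z|³ + 17z² + 7|z| + 1)(1 − |z|)⁷` on `[−1,1]` and `0` outside. -/
theorem z_density_maximally_mixed :
    Measure.map (fun p : ℝ × ℝ × ℂ × ℂ × ℂ × ℂ × ℂ => p.1 + p.2.1 - 1)
        uniformQubitChannel
      = volume.withDensity (fun z : ℝ => if |z| ≤ 1 then
          ENNReal.ofReal ((20 / 11) * (z ^ 4 + 7 * |z| ^ 3 + 17 * z ^ 2 + 7 * |z| + 1)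
            * (1 - |z|) ^ 7)
        else 0) := by
  set η : ℝ → ENNReal := fun z => if |z| ≤ 1 then
          ENNReal.ofReal ((20 / 11) * (z ^ 4 + 7 * |z| ^ 3 + 17 * z ^ 2 + 7 * |z| + 1)
            * (1 - |z|) ^ 7)
        else 0 with hη
  set K : ENNReal := sectionConst * ENNReal.ofReal (1 / 50400) with hK
  have hvol {s : Set ℝ} (hs : MeasurableSet s) :
      volume ((fun p : ℝ × ℝ × ℂ × ℂ × ℂ × ℂ × ℂ => p.1 + p.2.1 - 1) ⁻¹' s ∩ qubitChannelSet) =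
        K * ∫⁻ z in s, η z := by
    rw [volume_qubitChannelSet_inter_preimage hs, hK, mul_assoc,
      ← lintegral_const_mul' _ _ ENNReal.ofReal_ne_top]
    simp only [lintegral_sectionDensity, hη]
  have htotal : volume qubitChannelSet = K := by
    have h := hvol MeasurableSet.univ
    rwa [Set.preimage_univ, Set.univ_inter, setLIntegral_univ, lintegral_density, mul_one] at h
  have hK0 : K ≠ 0 := mul_ne_zero sectionConst_ne_zero (by simp)
  have hKtop : K ≠ ⊤ := ENNReal.mul_ne_top sectionConst_ne_top ENNReal.ofReal_ne_top
  have hmap : Measurable fun p : ℝ × ℝ × ℂ × ℂ × ℂ × ℂ × ℂ => p.1 + p.2.1 - 1 := by fun_prop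
  ext s hs
  rw [Measure.map_apply hmap hs, uniformQubitChannel, Measure.smul_apply,
    Measure.restrict_apply (hmap hs), hvol hs, htotal, withDensity_apply _ hs, smul_eq_mul,
    ← mul_assoc, ENNReal.inv_mul_cancel hK0 hKtop, one_mul]
end
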